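/- arXiv:1612.04206 — 2 statements merged into one kernel-verified Lean document; each statement's English description precedes it below -/
import Mathlib

section
/- Let n ≥ 3 and d be integers, let 𝓔 be a direct sum of three invertible sheaves on ℙ^{n−1} over ℂ, and let X be a very general member of the complete linear system |2D + dF| on the projective bundle ℙ_{ℙ^{n−1}}(𝓔), where D is the tautological divisor and F is the pullback of a hyperplane of ℙ^{n−1}. Suppose that the natural projection π : X → ℙ^{n−1} is a conic bundle. If X is singular, then X is rational. -/
/-!
Formalization framework for "Stable rationality of higher dimensional conic bundles"
(Ahmadinezhad–Okada).

We model a weighted-projective-space bundle `P` over `ℙ^{n-1}` (in particular the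
`ℙ²`-bundle `P_n(k,l,m) = ℙ(𝒪(-k) ⊕ 𝒪(-l) ⊕ 𝒪(-m))`, and the `ℙ(1,1,2)`-bundle `R`)
through its Cox ring `K[u_0,…,u_{n-1}, x_0,…,x_{m-1}]`, bigraded by
`deg u_i = (1,0)`, `deg x_j = (w j, a j)`, together with the action of the
two-dimensional torus on the affine cone.  A member `X` of the complete linear
system `|𝒪_P(α,β)| = |α F + β D|` (`F` the pullback of the hyperplane class of
`ℙ^{n-1}`, `D` the tautological class) is recorded by a bihomogeneous polynomial
`g` of bidegree `(α,β)`, and the projection `π : X → ℙ^{n-1}` is induced by the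
coordinates `u_0,…,u_{n-1}`.

Geometric notions are rendered as follows (all are genuine definitions):

* a *general* (resp. *very general*) member of a linear system: the property holds
  on a nonempty principal Zariski-open subset of the parameter space (resp. away
  from countably many proper closed subsets);
* smoothness of `X`: the Jacobian criterion on the punctured affine cone (where the
  torus acts freely the quotient map is a torsor, so this is smoothness of `X`);
* the function field `K(X)`: the degree-`(0,0)` part of the fraction field of the
  homogeneous coordinate ring `Cox/(g)`, i.e. the subalgebra generated by ratios of
  bihomogeneous elements of equal bidegree;
* rationality: `K(X)` is `K`-isomorphic to a purely transcendental extension of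
  `K` (i.e. `X` is birational to a projective space);
* stable rationality: `K(X)(x_1,…,x_r) ≅_K K(y_1,…,y_s)` for some `r,s`
  (i.e. `X × ℙ^r` is birational to a projective space);
* normality: the local rings of the relevant locus of the affine cone are
  integrally closed (the punctured cone is a smooth torsor over `X`);
* terminal singularities: rendered as `X` normal with singular locus of
  codimension at least 3, which is the form terminality takes for the general
  members appearing in the paper;
* ℚ-factoriality together with `ρ(X) = 2` (i.e. the divisor class group of `X` is
  spanned up to torsion by the fibre class `F` and the tautological class `D`):
  rendered by requiring every relevant bihomogeneous height-one prime `P` of the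
  coordinate ring of `X` to contain a bihomogeneous element lying in no other such
  prime (so that `div(f) = k·P` and `[P] ∈ ℚ⟨F, D⟩`);
* ampleness of `𝒪_X(α,β)`: some multiple is very ample, rendered by requiring the
  bihomogeneous sections of that multiple to be base point free, to separate
  points, and to separate tangent vectors (modulo the torus directions) on the
  cone over `X`;
* `π`-ampleness of `-K_X`: by adjunction `-K_X = 𝒪_X(e,1)` with
  `e = n + Σ w - deg g`, and relative ampleness over the projective base means
  some twist `𝒪_X(e+N,1)` by pullback classes from `ℙ^{n-1}` is ample;
* connectedness of the fibres of `π : X → ℙ^{n-1}`: no fibre admits a disjoint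
  covering by two zero sets of families of weighted-homogeneous polynomials, each
  meeting the fibre (i.e. Zariski-connectedness of the fibres), and all fibres are
  nonempty;
* a conic bundle (Mori fibre space of relative dimension one, Definition 2.5 of
  the paper): `X` is irreducible (the ideal of `g` is prime), normal, has only
  terminal singularities, `π` has connected fibres, `-K_X` is `π`-ample, and
  `ρ(X) = 2`; all in the above renderings.
-/

open MvPolynomial

set_option maxHeartbeats 1600000
set_option synthInstance.maxHeartbeats 400000

namespace ConicBundleFormalization

noncomputable section

variable (K : Type) [Field K]

/-! ### The Cox ring and bihomogeneity -/

/-- The Cox ring of an `(m-1)`-dimensional weighted-projective-space bundle over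
`ℙ^{n-1}`: variables `u_i` (`i : Fin n`) of bidegree `(1,0)` and fibre variables
`x_j` (`j : Fin m`) of bidegree `(w j, a j)`. -/
abbrev Cox (n m : ℕ) : Type := MvPolynomial (Fin n ⊕ Fin m) K

/-- `p` is bihomogeneous of bidegree `(α, β)` for the grading `deg u_i = (1,0)`,
`deg x_j = (w j, a j)`. -/
def IsBihom (n m : ℕ) (w : Fin m → ℤ) (a : Fin m → ℕ) (α : ℤ) (β : ℕ)
    (p : Cox K n m) : Prop :=
  ∀ e ∈ p.support,
    ((∑ i : Fin n, (e (Sum.inl i) : ℤ)) + ∑ j : Fin m, (e (Sum.inr j) : ℤ) * w j = α) ∧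
    ((∑ j : Fin m, e (Sum.inr j) * a j) = β)

/-- A polynomial in `u_0, …, u_{n-1}` is homogeneous of degree `d ∈ ℤ`
(for `d < 0` this forces `p = 0`). -/
def IsHomogZ (n : ℕ) (d : ℤ) (p : MvPolynomial (Fin n) K) : Prop :=
  ∀ e ∈ p.support, (∑ i : Fin n, (e i : ℤ)) = d

/-- A polynomial in the fibre variables is weighted-homogeneous of degree `e` for
the weights `a`. -/
def IsWHom (m : ℕ) (a : Fin m → ℕ) (e : ℕ) (q : MvPolynomial (Fin m) K) : Prop :=
  ∀ ex ∈ q.support, (∑ j : Fin m, ex j * a j) = e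

/-! ### Genericity: general and very general members of a linear system -/

/-- Evaluation of a polynomial `D` in the coefficients of `p`; such `D` are the
polynomial functions on the parameter space of the linear system. -/
def evalCoeff {n m : ℕ} (p : Cox K n m)
    (D : MvPolynomial ((Fin n ⊕ Fin m) →₀ ℕ) K) : K :=
  MvPolynomial.eval (fun e => p.coeff e) D

/-- `Pred` holds for a *general* member of the complete linear system of
bihomogeneous polynomials of bidegree `(α,β)`: it holds on a nonempty principal
Zariski-open subset of the parameter space. -/
def GenerallyHolds (n m : ℕ) (w : Fin m → ℤ) (a : Fin m → ℕ) (α : ℤ) (β : ℕ)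
    (Pred : Cox K n m → Prop) : Prop :=
  ∃ D : MvPolynomial ((Fin n ⊕ Fin m) →₀ ℕ) K,
    (∃ p₀, IsBihom K n m w a α β p₀ ∧ evalCoeff K p₀ D ≠ 0) ∧
    ∀ p, IsBihom K n m w a α β p → evalCoeff K p D ≠ 0 → Pred p

/-- `Pred` holds for a *very general* member of the complete linear system of
bihomogeneous polynomials of bidegree `(α,β)`: it holds away from countably many
proper Zariski-closed subsets of the parameter space. -/
def VeryGenerallyHolds (n m : ℕ) (w : Fin m → ℤ) (a : Fin m → ℕ) (α : ℤ) (β : ℕ)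
    (Pred : Cox K n m → Prop) : Prop :=
  ∃ D : ℕ → MvPolynomial ((Fin n ⊕ Fin m) →₀ ℕ) K,
    (∀ i, ∃ p₀, IsBihom K n m w a α β p₀ ∧ evalCoeff K p₀ (D i) ≠ 0) ∧
    ∀ p, IsBihom K n m w a α β p → (∀ i, evalCoeff K p (D i) ≠ 0) → Pred p

/-- Evaluation of a polynomial `D` in the coefficients of a quadruple
`(a,b,c,f)` of polynomials in `u_0,…,u_{n-1}`. -/
def evalCoeff4 {n : ℕ} (abcf : Fin 4 → MvPolynomial (Fin n) K)
    (D : MvPolynomial (Fin 4 × (Fin n →₀ ℕ)) K) : K :=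
  MvPolynomial.eval (fun q => (abcf q.1).coeff q.2) D

/-- `Pred` holds for a *general* quadruple `(a,b,c,f)` of homogeneous polynomials
in `u_0,…,u_{n-1}` of respective degrees `degs 0, …, degs 3`. -/
def GenerallyHolds4 (n : ℕ) (degs : Fin 4 → ℤ)
    (Pred : (Fin 4 → MvPolynomial (Fin n) K) → Prop) : Prop :=
  ∃ D : MvPolynomial (Fin 4 × (Fin n →₀ ℕ)) K,
    (∃ abcf : Fin 4 → MvPolynomial (Fin n) K,
      (∀ i, IsHomogZ K n (degs i) (abcf i)) ∧ evalCoeff4 K abcf D ≠ 0) ∧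
    ∀ abcf : Fin 4 → MvPolynomial (Fin n) K,
      (∀ i, IsHomogZ K n (degs i) (abcf i)) → evalCoeff4 K abcf D ≠ 0 → Pred abcf

/-! ### Points of the bundle: the punctured affine cone and the torus action -/

/-- A point of the affine cone `𝔸^n × 𝔸^m` over the bundle. -/
abbrev Pt (n m : ℕ) : Type := (Fin n → K) × (Fin m → K)

/-- Evaluation of a Cox ring element at a point of the affine cone. -/
def evalPt {n m : ℕ} (p : Pt K n m) (f : Cox K n m) : K :=
  MvPolynomial.eval (Sum.elim p.1 p.2) f

/-- Membership in the complement of the irrelevant locus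
`V(u_0,…,u_{n-1}) ∪ V(x_0,…,x_{m-1})`. -/
def InCone {n m : ℕ} (p : Pt K n m) : Prop := p.1 ≠ 0 ∧ p.2 ≠ 0

/-- Equivalence of two cone points under the action of the torus `𝔾_m²`:
`(s,t)·(u,x) = (s·u_i, s^{w j} t^{a j}·x_j)`.  The points of the bundle are the
equivalence classes of points of the punctured cone. -/
def ToricEq {n m : ℕ} (w : Fin m → ℤ) (a : Fin m → ℕ) (p q : Pt K n m) : Prop :=
  ∃ s t : Kˣ, (∀ i, q.1 i = (s : K) * p.1 i) ∧
    (∀ j, q.2 j = ((s ^ (w j) : Kˣ) : K) * (t : K) ^ (a j) * p.2 j)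

/-- The punctured affine cone over the member `X = {g = 0}`. -/
def XCone {n m : ℕ} (g : Cox K n m) : Set (Pt K n m) :=
  {p | InCone K p ∧ evalPt K p g = 0}

/-! ### Smoothness via the Jacobian criterion on the cone -/

/-- The hypersurface `{g = 0}` is smooth along (the image of) `S ⊆ 𝔸^n × 𝔸^m`: at
every point of `S` lying on the cone over `X` some partial derivative of `g` is
nonzero.  On loci where the torus acts freely this is the Jacobian criterion for
smoothness of `X` itself. -/
def JacobiSmoothOn {n m : ℕ} (g : Cox K n m) (S : Set (Pt K n m)) : Prop :=
  ∀ p ∈ S, evalPt K p g = 0 → ∃ v : Fin n ⊕ Fin m, evalPt K p (pderiv v g) ≠ 0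

/-- The member `X = {g = 0}` of the linear system is smooth (nonsingular). -/
def IsSmoothModel {n m : ℕ} (g : Cox K n m) : Prop :=
  JacobiSmoothOn K g {p | InCone K p}

/-! ### The function field, rationality, and stable rationality -/

/-- The homogeneous coordinate ring `Cox/(g)` of the member `X = {g = 0}`,
i.e. the coordinate ring of the affine cone over `X`. -/
abbrev coneRing {n m : ℕ} (g : Cox K n m) : Type :=
  Cox K n m ⧸ Ideal.span {g}

/-- The total fraction ring of the affine cone over `X`; the function field of the
cone when `g` is prime. -/
def FracCone {n m : ℕ} (g : Cox K n m) : Type := FractionRing (coneRing K g)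

instance {n m : ℕ} (g : Cox K n m) : CommRing (FracCone K g) :=
  inferInstanceAs (CommRing (FractionRing (coneRing K g)))

instance {n m : ℕ} (g : Cox K n m) : Algebra K (FracCone K g) :=
  inferInstanceAs (Algebra K (FractionRing (coneRing K g)))

instance {n m : ℕ} (g : Cox K n m) : Algebra (coneRing K g) (FracCone K g) :=
  inferInstanceAs (Algebra (coneRing K g) (FractionRing (coneRing K g)))

/-- The canonical map from the Cox ring to the fraction ring of the cone over `X`. -/
def toFrac {n m : ℕ} (g : Cox K n m) : Cox K n m →+* FracCone K g :=
  (algebraMap (coneRing K g) (FracCone K g)).comp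
    (Ideal.Quotient.mk (Ideal.span {g}))

/-- The set of degree-`(0,0)` fractions on the cone over `X`: ratios `p/q` of
bihomogeneous elements of equal bidegree (phrased multiplicatively, avoiding
inverses). -/
def ratioSet {n m : ℕ} (w : Fin m → ℤ) (a : Fin m → ℕ) (g : Cox K n m) :
    Set (FracCone K g) :=
  {φ | ∃ (α : ℤ) (β : ℕ) (p q : Cox K n m),
    IsBihom K n m w a α β p ∧ IsBihom K n m w a α β q ∧
    toFrac K g q ≠ 0 ∧ φ * toFrac K g q = toFrac K g p}

/-- The `K`-algebra of rational functions on `X = {g = 0}`: the fractions of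
degree `(0,0)`.  When `g` is prime this is the function field `K(X)`. -/
def functionFieldModel {n m : ℕ} (w : Fin m → ℤ) (a : Fin m → ℕ) (g : Cox K n m) :
    Subalgebra K (FracCone K g) :=
  Algebra.adjoin K (ratioSet K w a g)

/-- `X = {g = 0}` is rational: its function field is `K`-isomorphic to a purely
transcendental extension `K(y_1,…,y_N)` of `K`, i.e. `X` is birational to a
projective space. -/
def IsRationalModel {n m : ℕ} (w : Fin m → ℤ) (a : Fin m → ℕ) (g : Cox K n m) :
    Prop :=
  ∃ N : ℕ, Nonempty
    (functionFieldModel K w a g ≃ₐ[K] FractionRing (MvPolynomial (Fin N) K))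

/-- `X = {g = 0}` is stably rational: `X × ℙ^r` is birational to a projective
space for some `r`, i.e. `K(X)(x_1,…,x_r) ≅_K K(y_1,…,y_s)` for some `r, s`. -/
def IsStablyRationalModel {n m : ℕ} (w : Fin m → ℤ) (a : Fin m → ℕ)
    (g : Cox K n m) : Prop :=
  ∃ r s : ℕ, Nonempty
    ((FractionRing (MvPolynomial (Fin r) (functionFieldModel K w a g)))
      ≃ₐ[K] FractionRing (MvPolynomial (Fin s) K))

/-! ### Normality, terminal singularities, class group, ampleness, fibres -/

/-- A prime of the Cox ring is *relevant* if it does not contain either component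
of the irrelevant ideal `(u_0,…,u_{n-1}) ∩ (x_0,…,x_{m-1})`. -/
def RelevantPrime {n m : ℕ} (P : Ideal (Cox K n m)) : Prop :=
  (∃ i, X (Sum.inl i) ∉ P) ∧ (∃ j, X (Sum.inr j) ∉ P)

/-- `X = {g = 0}` is normal: the local rings of the relevant locus of its affine
cone are integrally closed (the punctured cone is a smooth torsor over `X`, so
this is normality of `X`). -/
def IsNormalModel {n m : ℕ} (g : Cox K n m) : Prop :=
  ∀ P : PrimeSpectrum (coneRing K g),
    ((∃ i, Ideal.Quotient.mk (Ideal.span {g}) (X (Sum.inl i)) ∉ P.asIdeal) ∧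
     (∃ j, Ideal.Quotient.mk (Ideal.span {g}) (X (Sum.inr j)) ∉ P.asIdeal)) →
    IsIntegrallyClosed (Localization.AtPrime P.asIdeal)

/-- The singular locus of `X = {g = 0}` has codimension at least `c`: every
relevant prime of the Cox ring containing `g` and all its partial derivatives has
height at least `c + 1` (the height in the cone exceeds the codimension in `X`
by one). -/
def SingularLocusCodimAtLeast {n m : ℕ} (g : Cox K n m) (c : ℕ) : Prop :=
  ∀ P : PrimeSpectrum (Cox K n m), RelevantPrime K P.asIdeal →
    g ∈ P.asIdeal → (∀ v : Fin n ⊕ Fin m, pderiv v g ∈ P.asIdeal) →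
    ((c + 1 : ℕ) : WithBot (WithTop ℕ)) ≤ ringKrullDim (Localization.AtPrime P.asIdeal)

/-- Rendering of "`X` has only terminal singularities" for the members considered
in the paper: `X` is normal and its singular locus has codimension at least 3
(cf. the proof of Lemma 2.8, where the general members with `2m > d > l+m` have
ordinary double points along a nonsingular center of codimension 3). -/
def HasOnlyTerminalSingularitiesModel {n m : ℕ} (g : Cox K n m) : Prop :=
  IsNormalModel K g ∧ SingularLocusCodimAtLeast K g 3

/-- An ideal of the Cox ring is bihomogeneous if it is generated by its
bihomogeneous elements. -/
def IsBihomIdeal {n m : ℕ} (w : Fin m → ℤ) (a : Fin m → ℕ)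
    (P : Ideal (Cox K n m)) : Prop :=
  P ≤ Ideal.span {f | f ∈ P ∧ ∃ α β, IsBihom K n m w a α β f}

/-- A prime divisor of `X = {g = 0}`: a relevant bihomogeneous prime of the Cox
ring containing `g` of height 2 (height 1 over `(g)`). -/
def IsPrimeDivisorOn {n m : ℕ} (w : Fin m → ℤ) (a : Fin m → ℕ) (g : Cox K n m)
    (P : PrimeSpectrum (Cox K n m)) : Prop :=
  g ∈ P.asIdeal ∧ RelevantPrime K P.asIdeal ∧ IsBihomIdeal K w a P.asIdeal ∧
    ringKrullDim (Localization.AtPrime P.asIdeal) = (2 : WithBot (WithTop ℕ))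

/-- Rendering of "`X` is ℚ-factorial with `ρ(X) = 2`", i.e. the divisor class
group of `X` is spanned up to torsion by the pullback `F` of the hyperplane class
and the tautological class `D`: every prime divisor `P` of `X` carries a
bihomogeneous form `f` vanishing on `P` and on no other prime divisor, so that
`div(f) = k·P` for some `k ≥ 1` and hence `[P] ∈ ℚ⟨F,D⟩` in `Cl(X) ⊗ ℚ`. -/
def ClassGroupSpannedByFD {n m : ℕ} (w : Fin m → ℤ) (a : Fin m → ℕ)
    (g : Cox K n m) : Prop :=
  ∀ P : PrimeSpectrum (Cox K n m), IsPrimeDivisorOn K w a g P →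
    ∃ (α : ℤ) (β : ℕ) (f : Cox K n m),
      f ∉ Ideal.span {g} ∧ IsBihom K n m w a α β f ∧ f ∈ P.asIdeal ∧
      ∀ Q : PrimeSpectrum (Cox K n m), IsPrimeDivisorOn K w a g Q → Q ≠ P →
        f ∉ Q.asIdeal

/-- Rendering of "`ρ(X) ≥ 3`": the divisor class group of `X` is not spanned up to
torsion by the fibre class `F` and the tautological class `D`. -/
def PicardRankAtLeastThree {n m : ℕ} (w : Fin m → ℤ) (a : Fin m → ℕ)
    (g : Cox K n m) : Prop :=
  ¬ ClassGroupSpannedByFD K w a g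

/-- The cone over the fibre of `π : X → ℙ^{n-1}` over the point `[u] ∈ ℙ^{n-1}`. -/
def fibreCone {n m : ℕ} (g : Cox K n m) (u : Fin n → K) : Set (Fin m → K) :=
  {v | v ≠ 0 ∧ evalPt K (u, v) g = 0}

/-- The fibres of `π : X → ℙ^{n-1}` are nonempty and connected: no fibre can be
covered by two disjoint nonempty closed subsets, closed subsets of the fibre
being cut out by weighted-homogeneous polynomials in the fibre variables. -/
def FibresNonemptyAndConnected {n m : ℕ} (a : Fin m → ℕ) (g : Cox K n m) : Prop :=
  ∀ u : Fin n → K, u ≠ 0 →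
    (fibreCone K g u).Nonempty ∧
    ∀ A B : Set (MvPolynomial (Fin m) K),
      (∀ q ∈ A ∪ B, ∃ e, IsWHom K m a e q) →
      (∀ v ∈ fibreCone K g u,
        (∀ q ∈ A, MvPolynomial.eval v q = 0) ∨ (∀ q ∈ B, MvPolynomial.eval v q = 0)) →
      (∀ v ∈ fibreCone K g u,
        ¬ ((∀ q ∈ A, MvPolynomial.eval v q = 0) ∧ (∀ q ∈ B, MvPolynomial.eval v q = 0))) →
      ¬ ((∃ v ∈ fibreCone K g u, ∀ q ∈ A, MvPolynomial.eval v q = 0) ∧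
         (∃ v ∈ fibreCone K g u, ∀ q ∈ B, MvPolynomial.eval v q = 0))

/-- The infinitesimal generator of the first torus factor at a cone point. -/
def orbitVec₁ {n m : ℕ} (w : Fin m → ℤ) (p : Pt K n m) : (Fin n ⊕ Fin m) → K :=
  Sum.elim (fun i => p.1 i) (fun j => (w j : K) * p.2 j)

/-- The infinitesimal generator of the second torus factor at a cone point. -/
def orbitVec₂ {n m : ℕ} (a : Fin m → ℕ) (p : Pt K n m) : (Fin n ⊕ Fin m) → K :=
  Sum.elim (fun _ => 0) (fun j => (a j : K) * p.2 j)

/-- The bihomogeneous forms of bidegree `(α,β)` have no base point on `X`. -/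
def BasePointFreeOnX {n m : ℕ} (w : Fin m → ℤ) (a : Fin m → ℕ) (g : Cox K n m)
    (α : ℤ) (β : ℕ) : Prop :=
  ∀ p ∈ XCone K g, ∃ s, IsBihom K n m w a α β s ∧ evalPt K p s ≠ 0

/-- The bihomogeneous forms of bidegree `(α,β)` separate the points of `X`. -/
def SeparatesPointsOnX {n m : ℕ} (w : Fin m → ℤ) (a : Fin m → ℕ) (g : Cox K n m)
    (α : ℤ) (β : ℕ) : Prop :=
  ∀ p ∈ XCone K g, ∀ q ∈ XCone K g, ¬ ToricEq K w a p q →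
    ∃ s₁ s₂, IsBihom K n m w a α β s₁ ∧ IsBihom K n m w a α β s₂ ∧
      evalPt K p s₁ * evalPt K q s₂ ≠ evalPt K q s₁ * evalPt K p s₂

/-- The bihomogeneous forms of bidegree `(α,β)` separate the tangent vectors of
`X`: for every cone point `p` of `X` and every tangent vector `t` of the cone over
`X` at `p` not tangent to the torus orbit, some form vanishing at `p` has nonzero
derivative along `t`. -/
def SeparatesTangentsOnX {n m : ℕ} (w : Fin m → ℤ) (a : Fin m → ℕ) (g : Cox K n m)
    (α : ℤ) (β : ℕ) : Prop :=
  ∀ p ∈ XCone K g, ∀ t : (Fin n ⊕ Fin m) → K,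
    (∑ v : Fin n ⊕ Fin m, t v * evalPt K p (pderiv v g)) = 0 →
    t ∉ Submodule.span K {orbitVec₁ K w p, orbitVec₂ K a p} →
    ∃ s, IsBihom K n m w a α β s ∧ evalPt K p s = 0 ∧
      (∑ v : Fin n ⊕ Fin m, t v * evalPt K p (pderiv v s)) ≠ 0

/-- The class `𝒪_X(α,β)` is ample on `X = {g = 0}`: some positive multiple is very
ample, i.e. its forms are base point free on `X` and separate points and tangent
vectors. -/
def IsAmpleClassOnX {n m : ℕ} (w : Fin m → ℤ) (a : Fin m → ℕ) (g : Cox K n m)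
    (α : ℤ) (β : ℕ) : Prop :=
  ∃ t : ℕ, 0 < t ∧
    BasePointFreeOnX K w a g (t * α) (t * β) ∧
    SeparatesPointsOnX K w a g (t * α) (t * β) ∧
    SeparatesTangentsOnX K w a g (t * α) (t * β)

/-- The canonical class of the ambient bundle `P`, by the toric formula
`K_P = -Σ deg(variables)`. -/
def ambientCanonicalClass (n m : ℕ) (w : Fin m → ℤ) : ℤ × ℤ :=
  (-(n : ℤ) - ∑ j : Fin m, w j, -(m : ℤ))

/-- The anticanonical class `-K_X = -(K_P + X)|_X` of a member `X ∈ |𝒪_P(α,β)|`,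
by adjunction. -/
def memberAntiCanonicalClass (n m : ℕ) (w : Fin m → ℤ) (α : ℤ) (β : ℕ) : ℤ × ℤ :=
  (-((ambientCanonicalClass n m w).1 + α), -((ambientCanonicalClass n m w).2 + β))

/-- `-K_X` is `π`-ample for the projection `π : X → ℙ^{n-1}`: some twist of `-K_X`
by the pullback of a (sufficiently ample) divisor on the base is ample. -/
def AntiCanonicalIsRelativelyAmple {n m : ℕ} (w : Fin m → ℤ) (a : Fin m → ℕ)
    (g : Cox K n m) (α : ℤ) (β : ℕ) : Prop :=
  ∃ N : ℤ,
    IsAmpleClassOnX K w a g ((memberAntiCanonicalClass n m w α β).1 + N)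
      (memberAntiCanonicalClass n m w α β).2.toNat

/-- Rendering of Definition 2.5 of the paper: the projection
`π : X → ℙ^{n-1}` of the member `X = {g = 0} ∈ |𝒪_P(d,2)|` of the `ℙ²`-bundle
`P = P_n(w 0, w 1, w 2)` over `ℙ^{n-1}` is a *conic bundle*, i.e. a Mori fibre
space of relative dimension one: `X` is an (irreducible, normal, projective)
variety with only terminal singularities, `π` has connected fibres, `-K_X` is
`π`-ample, and `X` is ℚ-factorial of Picard rank `ρ(X) = 2`.  (Being embedded in
`|𝒪_P(d,2)|` of a projectivized split rank-3 bundle, this is an *embedded* conic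
bundle in the sense of Definition 2.6.) -/
structure IsConicBundleModel (n : ℕ) (w : Fin 3 → ℤ) (d : ℤ) (g : Cox K n 3) :
    Prop where
  bihom : IsBihom K n 3 w (fun _ => 1) d 2 g
  integral : (Ideal.span {g} : Ideal (Cox K n 3)).IsPrime
  normal : IsNormalModel K g
  terminal : HasOnlyTerminalSingularitiesModel K g
  connectedFibres : FibresNonemptyAndConnected K (fun _ => 1) g
  antiCanonicalRelAmple :
    AntiCanonicalIsRelativelyAmple K w (fun _ => 1) g d 2
  picardRankTwo : ClassGroupSpannedByFD K w (fun _ => 1) g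

/-! ### The discriminant of a conic bundle -/

/-- The coefficient of the monomial `x^e` (in the fibre variables) of `g`, as a
polynomial on the base. -/
def fibreCoeff {n m : ℕ} (g : Cox K n m) (e : Fin m →₀ ℕ) :
    MvPolynomial (Fin n) K :=
  ((MvPolynomial.sumAlgEquiv K (Fin m) (Fin n))
    (MvPolynomial.rename Sum.swap g)).coeff e

/-- The symmetric matrix of the fibrewise quadratic form of a member
`X = {g = 0} ∈ |𝒪_P(d,2)|` (over a field of characteristic zero). -/
def quadraticMatrix {n : ℕ} (g : Cox K n 3) :
    Matrix (Fin 3) (Fin 3) (MvPolynomial (Fin n) K) :=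
  fun i j =>
    if i = j then fibreCoeff K g (Finsupp.single i 2)
    else MvPolynomial.C ((2 : K)⁻¹) *
      fibreCoeff K g (Finsupp.single i 1 + Finsupp.single j 1)

/-- The equation of the discriminant divisor `Δ ⊂ ℙ^{n-1}` of the conic bundle
`π : X → ℙ^{n-1}`, `X = {g = 0}`: the determinant of the associated symmetric
matrix. -/
def discriminantPoly {n : ℕ} (g : Cox K n 3) : MvPolynomial (Fin n) K :=
  (quadraticMatrix K g).det

/-- The complete linear system `|k·K_{ℙ^{n-1}} + Δ|` is nonempty, where `Δ` is the
discriminant divisor of the conic bundle `X = {g = 0}`: the divisor class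
`𝒪(deg Δ - k·n)` on `ℙ^{n-1}` contains an effective divisor. -/
def KMultipleplusDiscriminantEffective {n : ℕ} (g : Cox K n 3) (k : ℕ) : Prop :=
  discriminantPoly K g ≠ 0 ∧
    ∃ h : MvPolynomial (Fin n) K, h ≠ 0 ∧
      IsHomogZ K n (((discriminantPoly K g).totalDegree : ℤ) - k * n) h

/-- `π : X → ℙ^{n-1}` is flat, i.e. no fibre is two-dimensional: `g` does not
vanish identically on any fibre of the ambient bundle.  Together with smoothness
of `X` this renders a *standard* conic bundle. -/
def ProjectionIsFlat {n m : ℕ} (g : Cox K n m) : Prop :=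
  ∀ u : Fin n → K, u ≠ 0 → ∃ v : Fin m → K, evalPt K (u, v) g ≠ 0

end

end ConicBundleFormalization

namespace ConicBundleFormalization

noncomputable section

variable (K : Type) [Field K]

/-! ### The special members `a x² + b y² + c z² + f x y` and the associated double
cover data in characteristic 2 -/

/-- The special member `X = {a x² + b y² + c z² + f x y = 0}` of
`|𝒪_P(λ+μ+ν, 2)|`, `P = P_n(λ,μ,ν)`, built from a quadruple `(a,b,c,f)` of
polynomials on the base (equation (3.1) of the paper). -/
def specialMemberX {n : ℕ} (abcf : Fin 4 → MvPolynomial (Fin n) K) : Cox K n 3 :=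
  rename Sum.inl (abcf 0) * X (Sum.inr 0) ^ 2 +
  rename Sum.inl (abcf 1) * X (Sum.inr 1) ^ 2 +
  rename Sum.inl (abcf 2) * X (Sum.inr 2) ^ 2 +
  rename Sum.inl (abcf 3) * X (Sum.inr 0) * X (Sum.inr 1)

/-- The hypersurface `Z = {a x² + b y² + c z̄ + f x y = 0}` in the
`ℙ(1,1,2)`-bundle `R` over `ℙ^{n-1}` (with `z̄` the third fibre variable, of
weight 2), the image of `X` under the purely inseparable double cover `P → R` in
characteristic 2. -/
def specialMemberZ {n : ℕ} (abcf : Fin 4 → MvPolynomial (Fin n) K) : Cox K n 3 :=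
  rename Sum.inl (abcf 0) * X (Sum.inr 0) ^ 2 +
  rename Sum.inl (abcf 1) * X (Sum.inr 1) ^ 2 +
  rename Sum.inl (abcf 2) * X (Sum.inr 2) +
  rename Sum.inl (abcf 3) * X (Sum.inr 0) * X (Sum.inr 1)

/-! ### Admissible critical points (Definition 3.5 of the paper) -/

/-- A polynomial `F` in `N` variables over a field of characteristic 2 is in
*admissible normal form* at the origin: its linear part vanishes (a critical
point) and, up to an additive constant and higher-order terms,
`F = α + x₀x₁ + x₂x₃ + ⋯ + x_{N-2}x_{N-1}` if `N` is even, and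
`F = α + βx₀² + x₁x₂ + ⋯ + x_{N-2}x_{N-1} + (nonzero)·x₀³ + ⋯` if `N` is odd. -/
def AdmissibleNormalForm {N : ℕ} (F : MvPolynomial (Fin N) K) : Prop :=
  (∀ i, F.coeff (Finsupp.single i 1) = 0) ∧
  (N % 2 = 0 →
    (∀ i, F.coeff (Finsupp.single i 2) = 0) ∧
    (∀ i j : Fin N, (i : ℕ) < (j : ℕ) →
      F.coeff (Finsupp.single i 1 + Finsupp.single j 1) =
        (if (i : ℕ) % 2 = 0 ∧ (j : ℕ) = (i : ℕ) + 1 then 1 else 0))) ∧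
  (N % 2 = 1 →
    (∀ i : Fin N, (i : ℕ) ≠ 0 → F.coeff (Finsupp.single i 2) = 0) ∧
    (∀ i j : Fin N, (i : ℕ) < (j : ℕ) →
      F.coeff (Finsupp.single i 1 + Finsupp.single j 1) =
        (if (i : ℕ) % 2 = 1 ∧ (j : ℕ) = (i : ℕ) + 1 then 1 else 0)) ∧
    (∀ h0 : 0 < N, F.coeff (Finsupp.single (⟨0, h0⟩ : Fin N) 3) ≠ 0))

/-- A local function `F` (a polynomial in the local coordinates indexed by `ι`,
centred at the origin) has an *admissible critical point* at the origin: after a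
suitable (linear) change of coordinates it is in admissible normal form. -/
def AdmissibleLocalFunction {ι : Type} [Fintype ι] (F : MvPolynomial ι K) : Prop :=
  ∃ (N : ℕ) (e : ι ≃ Fin N) (T : Matrix (Fin N) (Fin N) K), IsUnit T.det ∧
    AdmissibleNormalForm K
      ((aeval (fun i : ι => ∑ j : Fin N, MvPolynomial.C (T (e i) j) * X j)) F)

/-- The local expression of the section `z̄` of `𝓛²` on the chart `x = 1` of `Z`
(multiplied by the square unit `c̃²`, i.e. computed with respect to the local
generator `c̃·ξ` of `𝓛`): the polynomial `c·(a + b·y² + f·y)` in the base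
variables and the remaining fibre variable `y`. -/
def chartPolyX {n : ℕ} (abcf : Fin 4 → MvPolynomial (Fin n) K) :
    MvPolynomial (Fin n ⊕ Fin 1) K :=
  rename Sum.inl (abcf 2) *
    (rename Sum.inl (abcf 0) + rename Sum.inl (abcf 1) * X (Sum.inr 0) ^ 2 +
      rename Sum.inl (abcf 3) * X (Sum.inr 0))

/-- The local expression of the section `z̄` on the chart `y = 1` of `Z`:
the polynomial `c·(a·x² + b + f·x)`. -/
def chartPolyY {n : ℕ} (abcf : Fin 4 → MvPolynomial (Fin n) K) :
    MvPolynomial (Fin n ⊕ Fin 1) K :=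
  rename Sum.inl (abcf 2) *
    (rename Sum.inl (abcf 0) * X (Sum.inr 0) ^ 2 + rename Sum.inl (abcf 1) +
      rename Sum.inl (abcf 3) * X (Sum.inr 0))

/-- Translation of a chart polynomial to local coordinates centred at the point
with base coordinates `u0` (normalized by `u0 i0 = 1`) and fibre coordinate `y0`:
substitute `u_{i0} ↦ 1`, `u_j ↦ u_j + u0 j` and `y ↦ y + y0`.  The variables are
the genuine local coordinates `{u_j : j ≠ i0} ∪ {y}` of `Z` at that point. -/
def localAt {n : ℕ} (i0 : Fin n) (u0 : Fin n → K) (y0 : K)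
    (G : MvPolynomial (Fin n ⊕ Fin 1) K) :
    MvPolynomial ({ j : Fin n // j ≠ i0 } ⊕ Fin 1) K :=
  aeval (Sum.elim
    (fun j => if h : j = i0 then 1 else X (Sum.inl ⟨j, h⟩) + MvPolynomial.C (u0 j))
    (fun _ => X (Sum.inr 0) + MvPolynomial.C y0)) G

/-- The section `z̄` of `𝓛²` on `Z = {gZ = 0}` has a *critical point* at the point
below the normalized cone point `p` (with `u_{i0} = 1` and the fibre coordinate
`jfix ∈ {x, y}` normalized to 1): the differential of `z̄` vanishes on the tangent
space of `Z` at that point, i.e. every chart tangent vector `t` of `Z` has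
vanishing `z̄`-component. -/
def CriticalPointOfZbar {n : ℕ} (gZ : Cox K n 3) (i0 : Fin n) (jfix : Fin 3)
    (p : Pt K n 3) : Prop :=
  ∀ t : (Fin n ⊕ Fin 3) → K, t (Sum.inl i0) = 0 → t (Sum.inr jfix) = 0 →
    (∑ v : Fin n ⊕ Fin 3, t v * evalPt K p (pderiv v gZ)) = 0 →
    t (Sum.inr 2) = 0

/-- `p` is a singular point of the cone over `X = {g = 0}`. -/
def SingularConePoint {n m : ℕ} (g : Cox K n m) (p : Pt K n m) : Prop :=
  p ∈ XCone K g ∧ ∀ v : Fin n ⊕ Fin m, evalPt K p (pderiv v g) = 0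

end

end ConicBundleFormalization

namespace ConicBundleFormalization

open MvPolynomial


theorem aux_closure {k F : Type*} [Field k] [Field F] [Algebra k F] (s : Set F) :
    (IntermediateField.adjoin k s : Set F) ⊆ (AlgebraicIndependent.matroid k F).closure s := by
  intro x hx
  rw [AlgebraicIndependent.matroid_closure_eq, SetLike.mem_coe]
  induction hx using IntermediateField.adjoin_induction with
  | mem x hx => exact isAlgebraic_algebraMap (⟨x, Algebra.subset_adjoin hx⟩ : Algebra.adjoin k s)
  | algebraMap x =>
    exact isAlgebraic_algebraMap (⟨algebraMap k F x, Subalgebra.algebraMap_mem _ x⟩ : Algebra.adjoin k s)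
  | add x y _ _ hx hy => exact add_mem hx hy
  | inv x _ hx => exact IsAlgebraic.inv hx
  | mul x y _ _ hx hy => exact mul_mem hx hy

theorem aux_card_le {k F ι : Type*} [Field k] [Field F] [Algebra k F] [Fintype ι]
    (c : ι → F) (hc : AlgebraicIndependent k c) (s : Set F)
    (h : ∀ i, c i ∈ IntermediateField.adjoin k s) :
    (Fintype.card ι : ℕ∞) ≤ (AlgebraicIndependent.matroid k F).eRk s := by
  have h1 : (AlgebraicIndependent.matroid k F).Indep (Set.range c) := by
    rw [AlgebraicIndependent.matroid_indep_iff]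
    exact hc.coe_range
  rw [← Matroid.eRk_closure_eq]
  refine le_trans ?_ (h1.encard_le_eRk_of_subset (X := (AlgebraicIndependent.matroid k F).closure s) ?_)
  · rw [← Set.image_univ, (hc.injective).encard_image, Set.encard_univ, ENat.card_eq_coe_fintype_card]
  · rintro _ ⟨i, rfl⟩
    exact aux_closure s (h i)

theorem aux_card_le_finset {k F ι : Type*} [Field k] [Field F] [Algebra k F] [Fintype ι]
    (c : ι → F) (hc : AlgebraicIndependent k c) (s : Finset F)
    (h : ∀ i, c i ∈ IntermediateField.adjoin k (s : Set F)) : Fintype.card ι ≤ s.card := by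
  have := (aux_card_le c hc _ h).trans (Matroid.eRk_le_encard _ _)
  rw [Set.encard_coe_eq_coe_finsetCard] at this
  exact_mod_cast this

theorem aux_indep {k F ι : Type*} [Field k] [Field F] [Algebra k F] [Fintype ι]
    (c : ι → F) (hc : AlgebraicIndependent k c) (b : ι → F)
    (h : ∀ i, c i ∈ IntermediateField.adjoin k (Set.range b)) : AlgebraicIndependent k b := by
  have h1 := aux_card_le c hc _ h
  have h2 := Matroid.eRk_le_encard (AlgebraicIndependent.matroid k F) (Set.range b)
  have h3 : (Set.range b).encard ≤ Fintype.card ι := by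
    rw [← Set.image_univ]
    refine (Set.encard_image_le _ _).trans ?_
    rw [Set.encard_univ, ENat.card_eq_coe_fintype_card]
  have hinj : Function.Injective b := by
    have h4 : (Fintype.card ι : ℕ∞) = (Set.range b).encard := le_antisymm (h1.trans h2) h3
    rw [← Set.injOn_univ]
    refine Set.Finite.injOn_of_encard_image_eq Set.finite_univ ?_
    rw [Set.image_univ, ← h4, Set.encard_univ, ENat.card_eq_coe_fintype_card]
  have h5 : (AlgebraicIndependent.matroid k F).Indep (Set.range b) := by
    rw [Matroid.indep_iff_eRk_eq_encard_of_finite (Set.finite_range b)]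
    exact le_antisymm h2 (h3.trans h1)
  rw [AlgebraicIndependent.matroid_indep_iff] at h5
  exact (algebraicIndependent_subtype_range hinj).1 h5


theorem aux_scale {K F : Type} [Field K] [Field F] [Algebra K F] {n m : ℕ} {w : Fin m → ℤ}
    {α : ℤ} {β : ℕ} {p : Cox K n m} (hp : IsBihom K n m w (fun _ => 1) α β p)
    (v : Fin n ⊕ Fin m → F) (s t : F) (hs : s ≠ 0) :
    aeval (Sum.elim (fun i => s * v (Sum.inl i)) (fun j => s ^ (w j) * t * v (Sum.inr j))) p
      = s ^ α * t ^ β * aeval v p := by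
  rw [aeval_def, aeval_def, eval₂_eq', eval₂_eq', Finset.mul_sum]
  refine Finset.sum_congr rfl fun e he => ?_
  obtain ⟨h1, h2⟩ := hp e he
  rw [Fintype.prod_sum_type, Fintype.prod_sum_type]
  simp only [Sum.elim_inl, Sum.elim_inr, mul_pow, Finset.prod_mul_distrib]
  have e1 : s ^ α = (∏ i : Fin n, s ^ e (Sum.inl i)) * ∏ j : Fin m, (s ^ w j) ^ e (Sum.inr j) := by
    rw [← h1, zpow_add₀ hs, Finset.prod_pow_eq_pow_sum]
    congr 1
    · rw [← Nat.cast_sum, zpow_natCast]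
    · have : ∀ S : Finset (Fin m), s ^ (∑ j ∈ S, (e (Sum.inr j) : ℤ) * w j) =
          ∏ j ∈ S, (s ^ w j) ^ e (Sum.inr j) := by
        intro S
        induction S using Finset.induction_on with
        | empty => simp
        | insert a S ha ih =>
          rw [Finset.sum_insert ha, Finset.prod_insert ha, zpow_add₀ hs, ih, mul_comm (e _ : ℤ),
            zpow_mul, zpow_natCast]
      exact this _
  have e2 : t ^ β = ∏ j : Fin m, t ^ e (Sum.inr j) := by
    rw [← h2, Finset.prod_pow_eq_pow_sum]; simp
  rw [e1, e2]
  ring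

theorem aux_pderiv_bihom {K : Type} [Field K] {n m : ℕ} {w : Fin m → ℤ}
    {α : ℤ} {β : ℕ} {p : Cox K n m} (hp : IsBihom K n m w (fun _ => 1) α β p)
    (v : Fin n ⊕ Fin m) : ∃ α' β', IsBihom K n m w (fun _ => 1) α' β' (pderiv v p) := by
  have key : ∀ e ∈ (pderiv v p).support, e + Finsupp.single v 1 ∈ p.support := by
    intro e he
    rw [mem_support_iff] at he ⊢
    intro h
    apply he
    rw [coeff_pderiv, h]
    simp
  rcases v with i | j
  · refine ⟨α - 1, β, fun e he => ?_⟩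
    obtain ⟨h1, h2⟩ := hp _ (key e he)
    simp [Finset.sum_add_distrib, Finsupp.single_apply] at h1 h2
    constructor
    · linarith
    · simpa using h2
  · refine ⟨α - w j, β - 1, fun e he => ?_⟩
    obtain ⟨h1, h2⟩ := hp _ (key e he)
    simp [Finset.sum_add_distrib, Finsupp.single_apply, add_mul] at h1 h2
    constructor
    · linarith
    · simp; omega

/-- the abstract dimension count -/
theorem aux_dim {σ : Type} [Fintype σ] [DecidableEq σ] (T : Finset (σ →₀ ℕ))
    (g : MvPolynomial σ ℂ) (hg : g.support ⊆ T)
    (hind : AlgebraicIndependent ℚ (fun t : T => g.coeff t.1))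
    (y : σ → ℂ) (A : Finset σ) (v0 : σ) (hv0 : v0 ∈ A) (e : σ → σ →₀ ℕ)
    (heT : ∀ v ∈ A, e v ∈ T)
    (h0 : ∀ v ∈ A, ∀ v' ∈ A, v ≠ v0 → v ≠ v' → e v' v = 0)
    (h1 : ∀ v ∈ A, e v v ≠ 0)
    (hm1 : ∀ v ∈ A, eval y (monomial (e v - Finsupp.single v 1) 1) = 1)
    (hmem : ∀ v ∈ A, ∀ t ∈ T, t v ≠ 0 → eval y (monomial (t - Finsupp.single v 1) 1) ∈
      IntermediateField.adjoin ℚ (y '' (A.erase v0 : Set σ)))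
    (hs : ∀ v ∈ A, eval y (pderiv v g) = 0) : False := by
  classical
  set s : Finset ℂ := (A.erase v0).image y ∪ (T \ A.image e).image (fun t => g.coeff t) with hsdef
  set M := IntermediateField.adjoin ℚ (s : Set ℂ) with hM
  have hsum : ∀ v, eval y (pderiv v g) =
      ∑ t ∈ T, g.coeff t * ((t v : ℂ) * eval y (monomial (t - Finsupp.single v 1) 1)) := by
    intro v
    have : g = ∑ t ∈ T, monomial t (g.coeff t) := by
      conv_lhs => rw [g.as_sum]
      refine Finset.sum_subset hg fun t _ ht => ?_
      rw [notMem_support_iff.1 ht, monomial_zero]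
    conv_lhs => rw [this]
    rw [map_sum, map_sum]
    refine Finset.sum_congr rfl fun t _ => ?_
    rw [pderiv_monomial, eval_monomial, eval_monomial]
    ring
  have hle : IntermediateField.adjoin ℚ (y '' (A.erase v0 : Set σ)) ≤ M := by
    apply IntermediateField.adjoin.mono
    intro x hx
    simp only [hsdef, Finset.coe_union, Finset.coe_image]
    exact Or.inl hx
  have hm : ∀ v ∈ A, ∀ t ∈ T, (t v : ℂ) * eval y (monomial (t - Finsupp.single v 1) 1) ∈ M := by
    intro v hv t ht
    by_cases h : t v = 0
    · rw [h]; simp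
    · exact mul_mem (natCast_mem M _) (hle (hmem v hv t ht h))
  have hout : ∀ t ∈ T, t ∉ A.image e → g.coeff t ∈ M := by
    intro t ht ht'
    apply IntermediateField.subset_adjoin
    simp only [hsdef, Finset.coe_union, Finset.coe_image]
    exact Or.inr ⟨t, by simp at ht' ⊢; exact ⟨ht, ht'⟩, rfl⟩
  have solve : ∀ v ∈ A, (∀ t ∈ T, t ≠ e v → g.coeff t *
      ((t v : ℂ) * eval y (monomial (t - Finsupp.single v 1) 1)) ∈ M) → g.coeff (e v) ∈ M := by
    intro v hv h
    have h2 := hs v hv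
    rw [hsum, ← Finset.add_sum_erase _ _ (heT v hv), hm1 v hv, mul_one] at h2
    have h3 : g.coeff (e v) = - (∑ x ∈ T.erase (e v), coeff x g *
      ((x v : ℂ) * eval y (monomial (x - Finsupp.single v 1) 1))) * ((e v v : ℕ) : ℂ)⁻¹ := by
      have : ((e v v : ℕ) : ℂ) ≠ 0 := Nat.cast_ne_zero.2 (h1 v hv)
      rw [eq_mul_inv_iff_mul_eq₀ this]
      linear_combination h2
    rw [h3]
    refine mul_mem (neg_mem (sum_mem fun t ht => ?_)) (inv_mem (natCast_mem M _))
    rw [Finset.mem_erase] at ht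
    exact h t ht.2 ht.1
  have hA : ∀ v ∈ A, v ≠ v0 → g.coeff (e v) ∈ M := by
    intro v hv hvv
    refine solve v hv fun t ht hte => ?_
    by_cases h : t ∈ A.image e
    · obtain ⟨v', hv', rfl⟩ := Finset.mem_image.1 h
      rw [h0 v hv v' hv' hvv (by rintro rfl; exact hte rfl)]
      simp
    · exact mul_mem (hout t ht h) (hm v hv t ht)
  have hall : ∀ t : T, g.coeff t.1 ∈ M := by
    have hv0' : g.coeff (e v0) ∈ M := by
      refine solve v0 hv0 fun t ht hte => mul_mem ?_ (hm v0 hv0 t ht)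
      by_cases h : t ∈ A.image e
      · obtain ⟨v', hv', rfl⟩ := Finset.mem_image.1 h
        exact hA v' hv' (by rintro rfl; exact hte rfl)
      · exact hout t ht h
    rintro ⟨t, ht⟩
    by_cases h : t ∈ A.image e
    · obtain ⟨v', hv', rfl⟩ := Finset.mem_image.1 h
      by_cases hv : v' = v0
      · subst hv; exact hv0'
      · exact hA v' hv' hv
    · exact hout t ht h
  have hcard := aux_card_le_finset _ hind s hall
  have hinj : Set.InjOn e A := by
    intro v hv v' hv' hvv
    by_contra hne
    by_cases h : v = v0
    · have := h0 v' hv' v hv (by rintro rfl; exact hne h) (Ne.symm hne)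
      rw [hvv] at this
      exact h1 v' hv' this
    · have := h0 v hv v' hv' h hne
      rw [← hvv] at this
      exact h1 v hv this
  have c1 : ((A.erase v0).image y).card ≤ A.card - 1 :=
    Finset.card_image_le.trans (by rw [Finset.card_erase_of_mem hv0])
  have c2 : ((T \ A.image e).image (fun t => g.coeff t)).card ≤ T.card - A.card := by
    refine Finset.card_image_le.trans ?_
    rw [Finset.card_sdiff_of_subset (by intro x hx; obtain ⟨v, hv, rfl⟩ := Finset.mem_image.1 hx; exact heT v hv),
      Finset.card_image_of_injOn hinj]
  have c3 : A.card ≤ T.card := by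
    rw [← Finset.card_image_of_injOn hinj]
    exact Finset.card_le_card (by intro x hx; obtain ⟨v, hv, rfl⟩ := Finset.mem_image.1 hx; exact heT v hv)
  have c4 : 0 < A.card := Finset.card_pos.2 ⟨v0, hv0⟩
  have c5 : s.card ≤ _ := Finset.card_union_le _ _
  rw [Fintype.card_coe] at hcard
  omega


def BiCond (n : ℕ) (w : Fin 3 → ℤ) (d : ℤ) (e : (Fin n ⊕ Fin 3) →₀ ℕ) : Prop :=
    ((∑ i : Fin n, (e (Sum.inl i) : ℤ)) + ∑ j : Fin 3, (e (Sum.inr j) : ℤ) * w j = d) ∧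
    ((∑ j : Fin 3, e (Sum.inr j)) = 2)

theorem bicond_finite (n : ℕ) (w : Fin 3 → ℤ) (d : ℤ) : {e | BiCond n w d e}.Finite := by
  let b : (Fin n ⊕ Fin 3) →₀ ℕ :=
    Finsupp.equivFunOnFinite.symm (fun _ => 2 + d.natAbs + 2 * ∑ j, (w j).natAbs)
  refine (Set.finite_Iic b).subset ?_
  rintro e ⟨h1, h2⟩ v
  simp only [b, Finsupp.equivFunOnFinite_symm_apply_apply]
  rcases v with i | j
  · have a1 : (e (Sum.inl i) : ℤ) ≤ ∑ i : Fin n, (e (Sum.inl i) : ℤ) :=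
      Finset.single_le_sum (f := fun i => (e (Sum.inl i) : ℤ)) (fun _ _ => by positivity) (Finset.mem_univ i)
    have a2 : ∀ j, -((e (Sum.inr j) : ℤ) * w j) ≤ 2 * (w j).natAbs := by
      intro j
      have : e (Sum.inr j) ≤ 2 := by
        rw [← h2]; exact Finset.single_le_sum (f := fun j => e (Sum.inr j)) (fun _ _ => Nat.zero_le _) (Finset.mem_univ j)
      have h3 : |w j| = ((w j).natAbs : ℤ) := Int.abs_eq_natAbs _
      rw [← h3]
      have h4 : (e (Sum.inr j) : ℤ) ≤ 2 := by exact_mod_cast this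
      have h5 := neg_le_abs (w j)
      have h6 := abs_nonneg (w j)
      nlinarith [(Nat.cast_nonneg (e (Sum.inr j)) : (0:ℤ) ≤ _)]
    have a3 := Finset.sum_le_sum (fun j (_ : j ∈ Finset.univ) => a2 j)
    rw [Finset.sum_neg_distrib, ← Finset.mul_sum] at a3
    have a4 : d ≤ d.natAbs := Int.le_natAbs
    have : (e (Sum.inl i) : ℤ) ≤ 2 + d.natAbs + 2 * ∑ j, ((w j).natAbs : ℤ) := by linarith
    exact_mod_cast this
  · have : e (Sum.inr j) ≤ 2 := by
      rw [← h2]; exact Finset.single_le_sum (f := fun j => e (Sum.inr j)) (fun _ _ => Nat.zero_le _) (Finset.mem_univ j)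
    omega

theorem aux_norm {n : ℕ} {w : Fin 3 → ℤ} {d : ℤ} {g : Cox ℂ n 3}
    (hg : IsBihom ℂ n 3 w (fun _ => 1) d 2 g) (p : Pt ℂ n 3) (i0 : Fin n) (j0 : Fin 3)
    (hi : p.1 i0 ≠ 0) (hj : p.2 j0 ≠ 0) (hs : ∀ v, evalPt ℂ p (pderiv v g) = 0) :
    ∃ y : Fin n ⊕ Fin 3 → ℂ, y (Sum.inl i0) = 1 ∧ y (Sum.inr j0) = 1 ∧
      (∀ j, p.2 j = 0 → y (Sum.inr j) = 0) ∧ ∀ v, eval y (pderiv v g) = 0 := by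
  let s : ℂ := (p.1 i0)⁻¹
  have hs0 : s ≠ 0 := inv_ne_zero hi
  let t : ℂ := (s ^ (w j0) * p.2 j0)⁻¹
  have hz : s ^ (w j0) ≠ 0 := zpow_ne_zero _ hs0
  refine ⟨Sum.elim (fun i => s * p.1 i) (fun j => s ^ (w j) * t * p.2 j), ?_, ?_, ?_, ?_⟩
  · simp [s, hi]
  · simp only [Sum.elim_inr, t]
    field_simp
  · intro j h
    simp [h]
  · intro v
    obtain ⟨α, β, h⟩ := aux_pderiv_bihom hg v
    have h2 := aux_scale h (Sum.elim p.1 p.2) s t hs0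
    have h3 := hs v
    rw [evalPt] at h3
    simp only [Sum.elim_inl, Sum.elim_inr] at h2
    rw [aeval_eq_eval, aeval_eq_eval, h3, mul_zero] at h2
    exact h2

theorem aux_smooth (n : ℕ) (d : ℤ) (w : Fin 3 → ℤ) (hw : ∀ j, 2 * w j ≤ d)
    (T : Finset ((Fin n ⊕ Fin 3) →₀ ℕ)) (hT : ∀ e, e ∈ T ↔ BiCond n w d e)
    (g : Cox ℂ n 3) (hg : IsBihom ℂ n 3 w (fun _ => 1) d 2 g)
    (hind : AlgebraicIndependent ℚ (fun t : T => g.coeff t.1)) : IsSmoothModel ℂ g := by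
  classical
  intro p hp _
  by_contra hcon
  push Not at hcon
  obtain ⟨i0, hi0⟩ : ∃ i, p.1 i ≠ 0 := Function.ne_iff.1 hp.1
  have hne : (Finset.univ.filter (fun j => p.2 j ≠ 0)).Nonempty := by
    obtain ⟨j, hj⟩ := Function.ne_iff.1 hp.2
    exact ⟨j, by simpa using hj⟩
  obtain ⟨j0, hj0, hmin⟩ := Finset.exists_min_image _ w hne
  simp only [Finset.mem_filter, Finset.mem_univ, true_and] at hj0 hmin
  obtain ⟨y, hy1, hy2, hy3, hy4⟩ := aux_norm hg p i0 j0 hi0 hj0 hcon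
  have hgT : g.support ⊆ T := by
    intro e he
    rw [hT]
    obtain ⟨a, b⟩ := hg e he
    exact ⟨a, by simpa using b⟩
  -- special monomials
  let r : Fin n ⊕ Fin 3 → (Fin n ⊕ Fin 3) →₀ ℕ := Sum.elim
    (fun _ => Finsupp.single (Sum.inr j0) 2 + Finsupp.single (Sum.inl i0) (d - 2 * w j0 - 1).toNat)
    (fun j => Finsupp.single (Sum.inr j0) 1 + Finsupp.single (Sum.inl i0) (d - w j - w j0).toNat)
  have hr : ∀ v v', v' ≠ Sum.inr j0 → v' ≠ Sum.inl i0 → r v v' = 0 := by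
    intro v v' h1 h2
    rcases v with i | j <;> simp [r, Finsupp.single_apply, Ne.symm h1, Ne.symm h2]
  have hry : ∀ v, eval y (monomial (r v) 1) = 1 := by
    intro v
    rw [eval_monomial, one_mul, Finsupp.prod]
    refine Finset.prod_eq_one fun v' hv' => ?_
    by_cases h1 : v' = Sum.inr j0
    · rw [h1, hy2, one_pow]
    by_cases h2 : v' = Sum.inl i0
    · rw [h2, hy1, one_pow]
    · exact absurd (hr v v' h1 h2) (Finsupp.mem_support_iff.1 hv')
  let e : Fin n ⊕ Fin 3 → (Fin n ⊕ Fin 3) →₀ ℕ := fun v => Finsupp.single v 1 + r v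
  have heinr : ∀ j, e (Sum.inr j) ∈ T := by
    intro j
    rw [hT]
    have := hw j
    have := hw j0
    have h0 : 0 ≤ d - w j - w j0 := by linarith
    have hk := Int.toNat_of_nonneg h0
    simp only [e, r, Sum.elim_inr]
    generalize (d - w j - w j0).toNat = k at hk ⊢
    constructor
    · simp [Finset.sum_add_distrib, Finsupp.single_apply, add_mul]
      linarith
    · simp [e, r, Finset.sum_add_distrib, Finsupp.single_apply]
  have heinl : 2 * w j0 < d → ∀ i, e (Sum.inl i) ∈ T := by
    intro hlt i
    rw [hT]
    have h0 : 0 ≤ d - 2 * w j0 - 1 := by linarith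
    have hk := Int.toNat_of_nonneg h0
    simp only [e, r, Sum.elim_inl]
    generalize (d - 2 * w j0 - 1).toNat = k at hk ⊢
    constructor
    · simp [Finset.sum_add_distrib, Finsupp.single_apply]
      linarith
    · simp [e, r, Finset.sum_add_distrib, Finsupp.single_apply]
  have key : ∀ A : Finset (Fin n ⊕ Fin 3), Sum.inr j0 ∈ A → Sum.inl i0 ∉ A →
      (∀ v ∈ A, e v ∈ T) →
      (∀ v ∈ A, ∀ t ∈ T, t v ≠ 0 → eval y (monomial (t - Finsupp.single v 1) 1) ∈
      IntermediateField.adjoin ℚ (y '' (A.erase (Sum.inr j0) : Set (Fin n ⊕ Fin 3)))) → False := by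
    intro A h1 h2 h3 h4
    refine aux_dim T g hgT hind y A (Sum.inr j0) h1 e h3 ?_ ?_ ?_ h4 (fun v _ => hy4 v)
    · intro v hv v' hv' ha hb
      have : v ≠ Sum.inl i0 := by rintro rfl; exact h2 hv
      simp [e, hr v' v ha this, Finsupp.single_apply, Ne.symm hb]
    · intro v hv
      simp [e]
    · intro v hv
      simp only [e, add_tsub_cancel_left]
      exact hry v
  rcases (hw j0).lt_or_eq with hlt | heq
  · refine key (Finset.univ.erase (Sum.inl i0)) (by simp) (by simp) ?_ ?_
    · rintro (i | j) _
      · exact heinl hlt i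
      · exact heinr j
    · intro v hv t ht _
      rw [eval_monomial, one_mul, Finsupp.prod]
      refine prod_mem fun v' _ => pow_mem ?_ _
      by_cases h1 : v' = Sum.inr j0
      · rw [h1, hy2]; exact one_mem _
      by_cases h2 : v' = Sum.inl i0
      · rw [h2, hy1]; exact one_mem _
      · exact IntermediateField.subset_adjoin _ _ ⟨v', by simp [h1, h2], rfl⟩
  · refine key ((Finset.univ.filter (fun j => 2 * w j = d)).image Sum.inr) (by simp [heq]) (by simp) ?_ ?_
    · intro v hv
      obtain ⟨j, _, rfl⟩ := Finset.mem_image.1 hv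
      exact heinr j
    · intro v hv t ht htv
      obtain ⟨j, hj, rfl⟩ := Finset.mem_image.1 hv
      simp only [Finset.mem_filter, Finset.mem_univ, true_and] at hj
      rw [eval_monomial, one_mul]
      by_cases hz : ∃ j', 2 * w j' ≠ d ∧ t (Sum.inr j') ≠ 0
      · obtain ⟨j', hj', htj'⟩ := hz
        have hjj : j ≠ j' := by rintro rfl; exact hj' hj
        have hy0 : y (Sum.inr j') = 0 := by
          apply hy3
          by_contra hne
          have := hmin j' hne
          have := hw j'
          omega
        have hts : (t - Finsupp.single (Sum.inr j) 1 : (Fin n ⊕ Fin 3) →₀ ℕ) (Sum.inr j') ≠ 0 := by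
          simpa [Finsupp.single_apply, hjj] using htj'
        have : ((t - Finsupp.single (Sum.inr j) 1).prod fun v k => y v ^ k) = 0 := by
          rw [Finsupp.prod]
          refine Finset.prod_eq_zero (i := Sum.inr j') (by simpa using hts) ?_
          rw [hy0, zero_pow hts]
        rw [this]; exact zero_mem _
      · push Not at hz
        have hsum : ∑ j' : Fin 3, (t (Sum.inr j') : ℤ) * (2 * w j') = 2 * d := by
          have : ∀ j' : Fin 3, (t (Sum.inr j') : ℤ) * (2 * w j') = t (Sum.inr j') * d := by
            intro j'
            by_cases h : 2 * w j' = d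
            · rw [h]
            · rw [hz j' h]; simp
          rw [Finset.sum_congr rfl fun j' _ => this j', ← Finset.sum_mul]
          have h2 := ((hT t).1 ht).2
          have h2' : (∑ j : Fin 3, (t (Sum.inr j) : ℤ)) = 2 := by exact_mod_cast h2
          rw [h2']
        have h1 := ((hT t).1 ht).1
        have hu : ∑ i : Fin n, (t (Sum.inl i) : ℤ) = 0 := by
          have : ∑ j' : Fin 3, (t (Sum.inr j') : ℤ) * (2 * w j') =
            2 * ∑ j' : Fin 3, (t (Sum.inr j') : ℤ) * (w j') := by
            rw [Finset.mul_sum]; exact Finset.sum_congr rfl fun _ _ => by ring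
          linarith
        have hu' : ∀ i, t (Sum.inl i) = 0 := by
          intro i
          have := (Finset.sum_eq_zero_iff_of_nonneg (fun i _ => by positivity)).1 hu i (Finset.mem_univ i)
          exact_mod_cast this
        rw [Finsupp.prod]
        refine prod_mem fun v' hv' => pow_mem ?_ _
        rcases v' with i | j'
        · exfalso
          simp [hu' i] at hv'
        · by_cases h1 : j' = j0
          · rw [h1, hy2]; exact one_mem _
          · refine IntermediateField.subset_adjoin _ _ ⟨Sum.inr j', ?_, rfl⟩
            have : 2 * w j' = d := by
              by_contra hne
              have := hz j' hne
              simp [this] at hv'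
            simp [h1, this]


theorem aux_case2 (n : ℕ) (d : ℤ) (w : Fin 3 → ℤ) (hw : ∀ j, 2 * w j ≤ d) :
    VeryGenerallyHolds ℂ n 3 w (fun _ => 1) d 2 (fun g => IsSmoothModel ℂ g) := by
  classical
  let T : Finset ((Fin n ⊕ Fin 3) →₀ ℕ) := (bicond_finite n w d).toFinset
  have hT : ∀ e, e ∈ T ↔ BiCond n w d e := by intro e; simp [T]
  have hc : Countable (MvPolynomial T ℚ) := by
    rw [← Cardinal.mk_le_aleph0_iff]
    refine MvPolynomial.cardinalMk_le_max.trans ?_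
    simp
  have : Nonempty {q : MvPolynomial T ℚ // q ≠ 0} := ⟨⟨1, one_ne_zero⟩⟩
  obtain ⟨f, hf⟩ := exists_surjective_nat {q : MvPolynomial T ℚ // q ≠ 0}
  have hev : ∀ (p : Cox ℂ n 3) (q : MvPolynomial T ℚ),
      evalCoeff ℂ p (rename Subtype.val (map (algebraMap ℚ ℂ) q)) =
        aeval (fun t : T => p.coeff t.1) q := by
    intro p q
    rw [evalCoeff, eval_rename, eval_map]
    rfl
  refine ⟨fun i => rename Subtype.val (map (algebraMap ℚ ℂ) (f i).1), fun i => ?_, fun p hp hD => ?_⟩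
  · have h0 : map (algebraMap ℚ ℂ) (f i).1 ≠ 0 := by
      rw [Ne, map_eq_zero_iff _ (map_injective _ (algebraMap ℚ ℂ).injective)]
      exact (f i).2
    obtain ⟨x, hx⟩ : ∃ x : T → ℂ, eval x (map (algebraMap ℚ ℂ) (f i).1) ≠ 0 := by
      by_contra hcon
      push Not at hcon
      exact h0 (MvPolynomial.funext fun x => by rw [hcon x, map_zero])
    let p₀ : Cox ℂ n 3 := ∑ t : T, monomial t.1 (x t)
    have hco : ∀ t : T, p₀.coeff t.1 = x t := by
      intro t
      simp only [p₀, coeff_sum, coeff_monomial, Subtype.val_inj]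
      simp
    refine ⟨p₀, ?_, ?_⟩
    · intro e he
      have : e ∈ T := by
        by_contra hne
        rw [mem_support_iff] at he
        apply he
        simp only [p₀, coeff_sum, coeff_monomial]
        refine Finset.sum_eq_zero fun t _ => if_neg ?_
        rintro rfl
        exact hne t.2
      obtain ⟨a, b⟩ := (hT e).1 this
      exact ⟨a, by simpa using b⟩
    · rw [evalCoeff, eval_rename]
      convert hx using 2
      congr 1
      funext t
      exact hco t
  · refine aux_smooth n d w hw T hT p hp ?_
    rw [algebraicIndependent_iff]
    intro q hq
    by_contra hne
    obtain ⟨i, hi⟩ := hf ⟨q, hne⟩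
    apply hD i
    rw [hev, hi]
    exact hq

/-- The prime ideal generated by two variables has height at most two. -/
theorem aux_height {σ : Type} [Finite σ] (a b : σ) (P : Ideal (MvPolynomial σ ℂ)) [P.IsPrime]
    (hP : P = Ideal.span {X a, X b}) :
    ringKrullDim (Localization.AtPrime P) ≤ 2 := by
  classical
  rw [IsLocalization.AtPrime.ringKrullDim_eq_height P]
  have h1 : P ∈ (Ideal.span (({X a, X b} : Finset (MvPolynomial σ ℂ)) : Set (MvPolynomial σ ℂ))).minimalPrimes := by
    have : Ideal.span (({X a, X b} : Finset (MvPolynomial σ ℂ)) : Set (MvPolynomial σ ℂ)) = P := by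
      rw [hP]; simp
    rw [this, Ideal.minimalPrimes_eq_subsingleton_self]
    rfl
  have h2 := Ideal.height_le_card_of_mem_minimalPrimes_span_finset h1
  have h3 : ((({X a, X b} : Finset (MvPolynomial σ ℂ)).card : ℕ) : ℕ∞) ≤ 2 := by
    exact_mod_cast Finset.card_le_two
  have h4 := h2.trans h3
  exact WithBot.coe_le_coe.2 h4

theorem aux_prime {σ : Type} (a b : σ) : (Ideal.span {X a, X b} : Ideal (MvPolynomial σ ℂ)).IsPrime := by
  classical
  let φ : MvPolynomial σ ℂ →ₐ[ℂ] MvPolynomial σ ℂ := aeval (fun v => if v = a ∨ v = b then 0 else X v)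
  have : (Ideal.span {X a, X b} : Ideal (MvPolynomial σ ℂ)) = RingHom.ker φ := by
    apply le_antisymm
    · rw [Ideal.span_le]
      rintro _ (rfl | rfl) <;> simp [φ, RingHom.mem_ker]
    · intro p hp
      have key : ∀ p, p - φ p ∈ (Ideal.span {X a, X b} : Ideal (MvPolynomial σ ℂ)) := by
        intro p
        rw [← Ideal.Quotient.eq]
        have : (Ideal.Quotient.mkₐ ℂ (Ideal.span {X a, X b} : Ideal (MvPolynomial σ ℂ))) =
            (Ideal.Quotient.mkₐ ℂ _).comp φ := by
          ext v
          simp only [φ, AlgHom.comp_apply, aeval_X, Ideal.Quotient.mkₐ_eq_mk]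
          split_ifs with h
          · rw [map_zero, Ideal.Quotient.eq_zero_iff_mem]
            apply Ideal.subset_span
            rcases h with rfl | rfl <;> simp
          · rfl
        exact DFunLike.congr_fun this p
      have := key p
      rw [RingHom.mem_ker] at hp
      rwa [hp, sub_zero] at this
  rw [this]
  exact RingHom.ker_isPrime _

theorem aux_not_cone {n : ℕ} (hn : 0 < n) {w : Fin 3 → ℤ} {d : ℤ} {g : Cox ℂ n 3}
    (hg : IsBihom ℂ n 3 w (fun _ => 1) d 2 g)
    (hc : SingularLocusCodimAtLeast ℂ g 3) (j0 j1 j2 : Fin 3) (h01 : j0 ≠ j1) (h02 : j0 ≠ j2)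
    (hall : ∀ j, j = j0 ∨ j = j1 ∨ j = j2) (h12 : j1 ≠ j2)
    (h : ∀ e ∈ g.support, e (Sum.inr j0) = 0) : False := by
  have := aux_prime (σ := Fin n ⊕ Fin 3) (Sum.inr j1) (Sum.inr j2)
  have himg : (Ideal.span {X (Sum.inr j1), X (Sum.inr j2)} : Ideal (Cox ℂ n 3)) =
      Ideal.span (X '' {Sum.inr j1, Sum.inr j2}) := by
    rw [Set.image_pair]
  have hsum : ∀ e ∈ g.support, e (Sum.inr j1) + e (Sum.inr j2) = 2 := by
    intro e he
    have h2 := (hg e he).2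
    have huniv : (Finset.univ : Finset (Fin 3)) = {j0, j1, j2} := by
      ext j; simpa using hall j
    rw [huniv, Finset.sum_insert (by simp [h01, h02]), Finset.sum_insert (by simpa using h12), Finset.sum_singleton, h e he] at h2
    simpa using h2
  have h4 := hc ⟨_, aux_prime (Sum.inr j1) (Sum.inr j2)⟩ ?_ ?_ ?_
  · have h5 := h4.trans (aux_height (Sum.inr j1) (Sum.inr j2) _ rfl)
    have h6 : (((3 + 1 : ℕ) : ℕ∞) : WithBot ℕ∞) ≤ ((2 : ℕ∞) : WithBot ℕ∞) := h5
    rw [WithBot.coe_le_coe] at h6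
    have h7 : (3 + 1 : ℕ) ≤ 2 := by exact_mod_cast h6
    omega
  · refine ⟨⟨⟨0, hn⟩, ?_⟩, ⟨j0, ?_⟩⟩
    · simp only [himg, mem_ideal_span_X_image]
      intro h
      have := h (Finsupp.single (Sum.inl ⟨0, hn⟩) 1) (by simp [support_X])
      simp at this
    · simp only [himg, mem_ideal_span_X_image]
      intro h
      have := h (Finsupp.single (Sum.inr j0) 1) (by simp [support_X])
      simp [Finsupp.single_apply, h01, h02] at this
  · simp only [himg, mem_ideal_span_X_image]
    intro e he
    have := hsum e he
    by_cases h1 : e (Sum.inr j1) = 0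
    · exact ⟨Sum.inr j2, by simp, by omega⟩
    · exact ⟨Sum.inr j1, by simp, h1⟩
  · intro v
    simp only [himg, mem_ideal_span_X_image]
    intro e he
    have hm : e + Finsupp.single v 1 ∈ g.support := by
      rw [mem_support_iff] at he ⊢
      intro h
      apply he
      rw [coeff_pderiv, h]
      simp
    have := hsum _ hm
    by_contra hcon
    push Not at hcon
    have e1 := hcon (Sum.inr j1) (by simp)
    have e2 := hcon (Sum.inr j2) (by simp)
    simp only [Finsupp.add_apply, e1, e2, Finsupp.single_apply, zero_add] at this
    split_ifs at this with k1 k2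
    · rw [k1] at k2; exact h12 (Sum.inr_injective k2)
    all_goals omega


theorem bihom_mul {n m : ℕ} {w : Fin m → ℤ} {α α' : ℤ} {β β' : ℕ} {p q : Cox ℂ n m}
    (hp : IsBihom ℂ n m w (fun _ => 1) α β p) (hq : IsBihom ℂ n m w (fun _ => 1) α' β' q) :
    IsBihom ℂ n m w (fun _ => 1) (α + α') (β + β') (p * q) := by
  classical
  intro e he
  obtain ⟨a, ha, b, hb, rfl⟩ := Finset.mem_add.1 (support_mul p q he)
  obtain ⟨h1, h2⟩ := hp a ha
  obtain ⟨h3, h4⟩ := hq b hb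
  simp only [Finsupp.add_apply, Nat.cast_add, add_mul, Finset.sum_add_distrib]
  simp only [mul_one] at h2 h4 ⊢
  exact ⟨by linarith, by omega⟩

theorem bihom_add {n m : ℕ} {w : Fin m → ℤ} {α : ℤ} {β : ℕ} {p q : Cox ℂ n m}
    (hp : IsBihom ℂ n m w (fun _ => 1) α β p) (hq : IsBihom ℂ n m w (fun _ => 1) α β q) :
    IsBihom ℂ n m w (fun _ => 1) α β (p + q) := by
  classical
  intro e he
  rcases Finset.mem_union.1 (support_add he) with h | h
  · exact hp e h
  · exact hq e h

theorem bihom_C {n m : ℕ} {w : Fin m → ℤ} (c : ℂ) :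
    IsBihom ℂ n m w (fun _ => 1) 0 0 (C c) := by
  classical
  intro e he
  have : e = 0 := by
    by_contra h
    rw [mem_support_iff, coeff_C, if_neg (Ne.symm h)] at he
    exact he rfl
  subst this
  simp

theorem bihom_inl {n m : ℕ} {w : Fin m → ℤ} (i : Fin n) :
    IsBihom ℂ n m w (fun _ => 1) 1 0 (X (Sum.inl i)) := by
  classical
  intro e he
  rw [support_X, Finset.mem_singleton] at he
  subst he
  simp [Finsupp.single_apply]

theorem bihom_inr {n m : ℕ} {w : Fin m → ℤ} (j : Fin m) :
    IsBihom ℂ n m w (fun _ => 1) (w j) 1 (X (Sum.inr j)) := by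
  classical
  intro e he
  rw [support_X, Finset.mem_singleton] at he
  subst he
  simp [Finsupp.single_apply]

theorem bihom_inl_pow {n m : ℕ} {w : Fin m → ℤ} (i : Fin n) (k : ℕ) :
    IsBihom ℂ n m w (fun _ => 1) k 0 (X (Sum.inl i) ^ k) := by
  induction k with
  | zero => simpa using bihom_C (n := n) (w := w) 1
  | succ k ih =>
    rw [pow_succ]
    have := bihom_mul ih (bihom_inl (w := w) i)
    simpa using this

theorem aux_mem {σ F : Type} [Fintype σ] [Field F] [Algebra ℂ F] (M : IntermediateField ℂ F)
    (f : σ → F) (p : MvPolynomial σ ℂ) (h : ∀ e ∈ p.support, ∀ a, e a ≠ 0 → f a ∈ M) :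
    aeval f p ∈ M := by
  rw [aeval_def, eval₂_eq']
  refine sum_mem fun e he => mul_mem (M.algebraMap_mem _) (prod_mem fun a _ => ?_)
  by_cases h0 : e a = 0
  · rw [h0, pow_zero]; exact one_mem _
  · exact pow_mem (h e he a h0) _

/-- degree zero fractions, abstractly -/
def absRatio {F : Type} [Field F] [Algebra ℂ F] {n : ℕ} (w : Fin 3 → ℤ)
    (τ : Cox ℂ n 3 →ₐ[ℂ] F) : Set F :=
  {φ | ∃ (α : ℤ) (β : ℕ) (p q : Cox ℂ n 3),
    IsBihom ℂ n 3 w (fun _ => 1) α β p ∧ IsBihom ℂ n 3 w (fun _ => 1) α β q ∧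
    τ q ≠ 0 ∧ φ * τ q = τ p}

theorem absRatio_adjoin {F : Type} [Field F] [Algebra ℂ F] {n : ℕ} (w : Fin 3 → ℤ)
    (τ : Cox ℂ n 3 →ₐ[ℂ] F) (s : Set F) (hs : s ⊆ absRatio w τ) :
    (IntermediateField.adjoin ℂ s : Set F) ⊆ absRatio w τ := by
  intro x hx
  induction hx using IntermediateField.adjoin_induction with
  | mem x hx => exact hs hx
  | algebraMap x =>
    refine ⟨0, 0, C x, C 1, bihom_C _, bihom_C _, by simp, ?_⟩
    rw [map_one, map_one, mul_one]
    exact (τ.commutes x).symm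
  | add x y _ _ hx hy =>
    obtain ⟨α, β, p, q, h1, h2, h3, h4⟩ := hx
    obtain ⟨α', β', p', q', h1', h2', h3', h4'⟩ := hy
    refine ⟨α + α', β + β', p * q' + q * p', q * q', bihom_add (bihom_mul h1 h2') (bihom_mul h2 h1'),
      bihom_mul h2 h2', by rw [map_mul]; exact mul_ne_zero h3 h3', ?_⟩
    rw [map_add, map_mul, map_mul, map_mul, ← h4, ← h4']
    ring
  | inv x _ hx =>
    obtain ⟨α, β, p, q, h1, h2, h3, h4⟩ := hx
    by_cases h : x = 0
    · rw [h, inv_zero, ← h]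
      exact ⟨α, β, p, q, h1, h2, h3, h4⟩
    · refine ⟨α, β, q, p, h2, h1, by rw [← h4]; exact mul_ne_zero h h3, ?_⟩
      rw [← h4]
      field_simp
  | mul x y _ _ hx hy =>
    obtain ⟨α, β, p, q, h1, h2, h3, h4⟩ := hx
    obtain ⟨α', β', p', q', h1', h2', h3', h4'⟩ := hy
    refine ⟨α + α', β + β', p * p', q * q', bihom_mul h1 h1',
      bihom_mul h2 h2', by rw [map_mul]; exact mul_ne_zero h3 h3', ?_⟩
    rw [map_mul, map_mul, ← h4, ← h4']
    ring

theorem aux_degz {σ : Type} (i : σ) (p : MvPolynomial σ ℂ) :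
    degreeOf i p = 0 ↔ ∀ e ∈ p.support, e i = 0 := by
  rw [← Nat.le_zero, degreeOf_le_iff]
  simp only [Nat.le_zero]

theorem aux_pair_inj {j1 j2 : Fin 3} (h12 : j1 ≠ j2) : Function.Injective ![j1, j2] := by
  intro a b hab
  fin_cases a <;> fin_cases b
  · rfl
  · exact absurd hab h12
  · exact absurd hab.symm h12
  · rfl

set_option maxHeartbeats 1600000 in
theorem aux_rational {F : Type} [Field F] [Algebra ℂ F] {n : ℕ} (i0 : Fin n) {w : Fin 3 → ℤ} {d : ℤ}
    {g : Cox ℂ n 3} (hg : IsBihom ℂ n 3 w (fun _ => 1) d 2 g)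
    (τ : Cox ℂ n 3 →ₐ[ℂ] F) (hker : ∀ p, τ p = 0 ↔ g ∣ p)
    (j0 j1 j2 : Fin 3) (h01 : j0 ≠ j1) (h02 : j0 ≠ j2) (h12 : j1 ≠ j2)
    (hall : ∀ j, j = j0 ∨ j = j1 ∨ j = j2) (hd : d < 2 * w j0)
    (hL : ∃ e ∈ g.support, e (Sum.inr j0) ≠ 0) :
    Nonempty (Algebra.adjoin ℂ (absRatio w τ) ≃ₐ[ℂ] FractionRing (MvPolynomial (Fin n) ℂ)) := by
  classical
  have hg0 : g ≠ 0 := by rintro rfl; simp at hL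
  have hnd : ∀ p : Cox ℂ n 3, (∀ e ∈ p.support, e (Sum.inr j0) = 0) → p ≠ 0 → τ p ≠ 0 := by
    intro p hp hp0 h
    obtain ⟨q, rfl⟩ := (hker p).1 h
    have hq0 : q ≠ 0 := by rintro rfl; simp at hp0
    have h1 := (aux_degz _ _).2 hp
    rw [degreeOf_mul_eq hg0 hq0] at h1
    obtain ⟨e, he, he0⟩ := hL
    exact he0 ((aux_degz (Sum.inr j0) g).1 (by omega) e he)
  set v : Fin n ⊕ Fin 3 → F := fun a => τ (X a) with hv
  have hτ : ∀ p, aeval v p = τ p := by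
    intro p
    exact (DFunLike.congr_fun (aeval_unique τ) p).symm
  have hvne : ∀ a, a ≠ Sum.inr j0 → v a ≠ 0 := by
    intro a ha
    refine hnd _ ?_ (X_ne_zero _)
    intro e he
    rw [support_X, Finset.mem_singleton] at he
    subst he
    simp [Finsupp.single_apply, ha]
  set s : F := (v (Sum.inl i0))⁻¹ with hs
  have hs0 : s ≠ 0 := inv_ne_zero (hvne _ (by simp))
  have hz : s ^ (w j1) ≠ 0 := zpow_ne_zero _ hs0
  have hv1 : v (Sum.inr j1) ≠ 0 := hvne _ (by simpa using h01.symm)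
  set t : F := (s ^ (w j1) * v (Sum.inr j1))⁻¹ with ht
  have ht0 : t ≠ 0 := inv_ne_zero (mul_ne_zero hz hv1)
  set y : Fin n ⊕ Fin 3 → F :=
    Sum.elim (fun i => s * v (Sum.inl i)) (fun j => s ^ (w j) * t * v (Sum.inr j)) with hy
  have hscale : ∀ (α : ℤ) (β : ℕ) (p : Cox ℂ n 3), IsBihom ℂ n 3 w (fun _ => 1) α β p →
      aeval y p = s ^ α * t ^ β * τ p := by
    intro α β p hp
    rw [← hτ]
    exact aux_scale hp v s t hs0
  have hy0 : y (Sum.inl i0) = 1 := by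
    simp only [hy, Sum.elim_inl, hs]
    exact inv_mul_cancel₀ (hvne _ (by simp))
  have hy1 : y (Sum.inr j1) = 1 := by
    simp only [hy, Sum.elim_inr, ht]
    field_simp
  let θ : Fin n → F := fun i => if i = i0 then y (Sum.inr j2) else y (Sum.inl i)
  set M := IntermediateField.adjoin ℂ (Set.range θ) with hM
  have hθM : ∀ i, θ i ∈ M := fun i => IntermediateField.subset_adjoin _ _ ⟨i, rfl⟩
  have hyinl : ∀ i, y (Sum.inl i) ∈ M := by
    intro i
    by_cases h : i = i0
    · rw [h, hy0]; exact one_mem _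
    · simpa [θ, h] using hθM i
  have hy2M : y (Sum.inr j2) ∈ M := by simpa [θ] using hθM i0
  have hy1M : y (Sum.inr j1) ∈ M := by rw [hy1]; exact one_mem _
  have hyM' : ∀ a, a ≠ Sum.inr j0 → y a ∈ M := by
    rintro (i | j) h
    · exact hyinl i
    · rcases hall j with rfl | rfl | rfl
      · exact absurd rfl h
      · exact hy1M
      · exact hy2M
  -- decomposition of g
  have hdec := divMonomial_add_modMonomial_single g (Sum.inr j0)
  set L := g.divMonomial (Finsupp.single (Sum.inr j0) 1) with hLdef
  set Q := g.modMonomial (Finsupp.single (Sum.inr j0) 1) with hQdef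
  have huniv : (Finset.univ : Finset (Fin 3)) = {j0, j1, j2} := by
    ext j; simpa using hall j
  have hle1 : ∀ e ∈ g.support, e (Sum.inr j0) ≤ 1 := by
    intro e he
    by_contra hcon
    obtain ⟨h1, h2⟩ := hg e he
    rw [huniv, Finset.sum_insert (by simp [h01, h02]), Finset.sum_insert (by simpa using h12),
      Finset.sum_singleton] at h1 h2
    simp only [mul_one] at h2
    have e1 : e (Sum.inr j1) = 0 := by omega
    have e2 : e (Sum.inr j2) = 0 := by omega
    have e0 : e (Sum.inr j0) = 2 := by omega
    have hpos : (0 : ℤ) ≤ ∑ i : Fin n, (e (Sum.inl i) : ℤ) := Finset.sum_nonneg fun _ _ => by positivity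
    rw [e0, e1, e2] at h1
    push_cast at h1
    linarith
  have hLsupp : ∀ e ∈ L.support, Finsupp.single (Sum.inr j0) 1 + e ∈ g.support := by
    intro e he
    rw [mem_support_iff, hLdef, coeff_divMonomial] at he
    exact mem_support_iff.2 he
  have hL0 : ∀ e ∈ L.support, e (Sum.inr j0) = 0 := by
    intro e he
    have := hle1 _ (hLsupp e he)
    simp at this
    exact this
  have hQ0 : ∀ e ∈ Q.support, e (Sum.inr j0) = 0 := by
    intro e he
    by_contra hne
    rw [mem_support_iff] at he
    apply he
    rw [hQdef, coeff_modMonomial_of_le]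
    simpa [Nat.one_le_iff_ne_zero] using hne
  have hLne : L ≠ 0 := by
    intro h
    obtain ⟨e, he, he0⟩ := hL
    rw [h, mul_zero, zero_add] at hdec
    rw [← hdec] at he
    exact he0 (hQ0 e he)
  have hLb : IsBihom ℂ n 3 w (fun _ => 1) (d - w j0) 1 L := by
    intro e he
    obtain ⟨h1, h2⟩ := hg _ (hLsupp e he)
    simp [Finset.sum_add_distrib, Finsupp.single_apply, add_mul] at h1 h2
    constructor
    · linarith
    · simp; omega
  have hρL : aeval y L ≠ 0 := by
    rw [hscale _ _ _ hLb]
    exact mul_ne_zero (mul_ne_zero (zpow_ne_zero _ hs0) (pow_ne_zero _ ht0)) (hnd L hL0 hLne)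
  have hρg : y (Sum.inr j0) * aeval y L + aeval y Q = 0 := by
    have h1 : aeval y g = 0 := by
      rw [hscale _ _ _ hg, (hker g).2 dvd_rfl, mul_zero]
    rw [← hdec, map_add, map_mul, aeval_X] at h1
    exact h1
  have hmem0 : ∀ p : Cox ℂ n 3, (∀ e ∈ p.support, e (Sum.inr j0) = 0) → aeval y p ∈ M := by
    intro p hp
    refine aux_mem M y p fun e he a ha => hyM' a ?_
    rintro rfl
    exact ha (hp e he)
  have hy0M : y (Sum.inr j0) ∈ M := by
    have : y (Sum.inr j0) = - aeval y Q / aeval y L := by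
      rw [eq_div_iff hρL]
      linear_combination hρg
    rw [this]
    exact div_mem (neg_mem (hmem0 Q hQ0)) (hmem0 L hL0)
  have hρM : ∀ p : Cox ℂ n 3, aeval y p ∈ M := by
    intro p
    refine aux_mem M y p fun e he a ha => ?_
    by_cases h : a = Sum.inr j0
    · rw [h]; exact hy0M
    · exact hyM' a h
  -- the function field is M
  have hsub1 : absRatio w τ ⊆ (M : Set F) := by
    rintro φ ⟨α, β, p, q, hp, hq, hq0, h⟩
    have h1 := hscale _ _ _ hp
    have h2 := hscale _ _ _ hq
    have hne : s ^ α * t ^ β ≠ 0 := mul_ne_zero (zpow_ne_zero _ hs0) (pow_ne_zero _ ht0)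
    have h3 : φ = aeval y p / aeval y q := by
      rw [eq_div_iff (by rw [h2]; exact mul_ne_zero hne hq0), h1, h2, ← h]
      ring
    rw [h3]
    exact div_mem (hρM p) (hρM q)
  have hsub2 : (M : Set F) ⊆ absRatio w τ := by
    apply absRatio_adjoin
    rintro _ ⟨i, rfl⟩
    by_cases hi : i = i0
    · simp only [θ, hi, if_true]
      have hu : v (Sum.inl i0) ≠ 0 := hvne _ (by simp)
      refine ⟨((w j1 - w j2).toNat : ℤ) + w j2, 0 + 1,
        X (Sum.inl i0) ^ (w j1 - w j2).toNat * X (Sum.inr j2),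
        X (Sum.inl i0) ^ (w j2 - w j1).toNat * X (Sum.inr j1),
        bihom_mul (bihom_inl_pow i0 _) (bihom_inr j2), ?_, ?_, ?_⟩
      · have : ((w j1 - w j2).toNat : ℤ) + w j2 = ((w j2 - w j1).toNat : ℤ) + w j1 := by omega
        rw [this]
        exact bihom_mul (bihom_inl_pow i0 _) (bihom_inr j1)
      · rw [map_mul, map_pow]
        exact mul_ne_zero (pow_ne_zero _ hu) hv1
      · rw [map_mul, map_pow, map_mul, map_pow]
        change s ^ (w j2) * t * v (Sum.inr j2) * (v (Sum.inl i0) ^ (w j2 - w j1).toNat * v (Sum.inr j1)) =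
          v (Sum.inl i0) ^ (w j1 - w j2).toNat * v (Sum.inr j2)
        rw [ht, hs]
        generalize v (Sum.inl i0) = U at hu ⊢
        have e1 : U ^ (w j1 - w j2).toNat = U ^ (w j1) * (U ^ (w j2))⁻¹ * U ^ (w j2 - w j1).toNat := by
          rw [← zpow_natCast, ← zpow_natCast, ← zpow_neg, ← zpow_add₀ hu, ← zpow_add₀ hu]
          congr 1
          omega
        rw [e1, inv_zpow, inv_zpow]
        have : U ^ (w j1) ≠ 0 := zpow_ne_zero _ hu
        have : U ^ (w j2) ≠ 0 := zpow_ne_zero _ hu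
        field_simp
    · simp only [θ, hi, if_false]
      refine ⟨1, 0, X (Sum.inl i), X (Sum.inl i0), bihom_inl _, bihom_inl _, hvne _ (by simp), ?_⟩
      change s * v (Sum.inl i) * v (Sum.inl i0) = v (Sum.inl i)
      have hu : v (Sum.inl i0) ≠ 0 := hvne _ (by simp)
      rw [hs]
      field_simp
  have heq : Algebra.adjoin ℂ (absRatio w τ) = M.toSubalgebra := by
    apply le_antisymm
    · exact Algebra.adjoin_le hsub1
    · intro x hx
      exact Algebra.subset_adjoin (hsub2 hx)
  -- independence
  let ι : Fin n ⊕ Fin 2 → Fin n ⊕ Fin 3 := Sum.map id ![j1, j2]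
  have hι : Function.Injective ι :=
    Function.Injective.sumMap Function.injective_id (aux_pair_inj h12)
  have hιj : ∀ a, ι a ≠ Sum.inr j0 := by
    rintro (i | a)
    · simp [ι]
    · fin_cases a
      · simpa [ι] using h01.symm
      · simpa [ι] using h02.symm
  have hcind : AlgebraicIndependent ℂ (fun a => v (ι a)) := by
    rw [algebraicIndependent_iff]
    intro p hp
    by_contra hne
    have h1 : τ (rename ι p) = 0 := by
      rw [← hτ, aeval_rename]
      exact hp
    refine hnd (rename ι p) ?_ ?_ h1
    · intro e he
      rw [support_rename_of_injective hι] at he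
      obtain ⟨e', _, rfl⟩ := Finset.mem_image.1 he
      apply Finsupp.mapDomain_of_notMem_range
      rintro ⟨a, ha⟩
      exact hιj a ha
    · rw [Ne, map_eq_zero_iff _ (rename_injective _ hι)]
      exact hne
  let b : Fin n ⊕ Fin 2 → F := Sum.elim θ ![v (Sum.inl i0), v (Sum.inr j1)]
  have hbind : AlgebraicIndependent ℂ b := by
    refine aux_indep _ hcind b ?_
    set N := IntermediateField.adjoin ℂ (Set.range b)
    have hMN : M ≤ N := by
      apply IntermediateField.adjoin.mono
      rintro _ ⟨i, rfl⟩
      exact ⟨Sum.inl i, rfl⟩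
    have hu : v (Sum.inl i0) ∈ N := IntermediateField.subset_adjoin _ _ ⟨Sum.inr 0, rfl⟩
    have hx : v (Sum.inr j1) ∈ N := IntermediateField.subset_adjoin _ _ ⟨Sum.inr 1, rfl⟩
    have hsN : s ∈ N := inv_mem hu
    have htN : t ∈ N := inv_mem (mul_mem (zpow_mem hsN _) hx)
    have hvN : ∀ a, a ≠ Sum.inr j0 → v a ∈ N := by
      intro a ha
      have h1 := hMN (hyM' a ha)
      rcases a with i | j
      · have : v (Sum.inl i) = y (Sum.inl i) / s := by
          rw [eq_div_iff hs0]; simp only [hy, Sum.elim_inl]; ring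
        rw [this]
        exact div_mem h1 hsN
      · have hz' : s ^ (w j) ≠ 0 := zpow_ne_zero _ hs0
        have : v (Sum.inr j) = y (Sum.inr j) / (s ^ (w j) * t) := by
          rw [eq_div_iff (mul_ne_zero hz' ht0)]; simp only [hy, Sum.elim_inr]; ring
        rw [this]
        exact div_mem h1 (mul_mem (zpow_mem hsN _) htN)
    intro a
    exact hvN _ (hιj a)
  have hθind : AlgebraicIndependent ℂ θ := hbind.comp Sum.inl Sum.inl_injective
  exact ⟨(Subalgebra.equivOfEq _ _ heq).trans hθind.aevalEquivField.symm⟩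

theorem aux_three (j0 : Fin 3) : ∃ j1 j2 : Fin 3, j0 ≠ j1 ∧ j0 ≠ j2 ∧ j1 ≠ j2 ∧
    ∀ j, j = j0 ∨ j = j1 ∨ j = j2 := by
  revert j0; decide

/-- **Theorem 1.1 (1).**  Let `n ≥ 3` and `d` be integers and `𝓔 = 𝒪(-w 0) ⊕ 𝒪(-w 1) ⊕ 𝒪(-w 2)`
a split rank-3 bundle on `ℙ^{n-1}` over `ℂ`.  If a very general member `X` of
`|2D + dF|` on `ℙ(𝓔)` is such that `π : X → ℙ^{n-1}` is a conic bundle and `X` is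
singular, then `X` is rational. -/
theorem thm_main_singular_rational
    (n : ℕ) (hn : 3 ≤ n) (d : ℤ) (w : Fin 3 → ℤ) :
    VeryGenerallyHolds ℂ n 3 w (fun _ => 1) d 2 (fun g =>
      IsConicBundleModel ℂ n w d g →
      ¬ IsSmoothModel ℂ g →
      IsRationalModel ℂ w (fun _ => 1) g) := by
  by_cases hw : ∀ j, 2 * w j ≤ d
  · obtain ⟨D, h1, h2⟩ := aux_case2 n d w hw
    exact ⟨D, h1, fun p hp hD _ hns => absurd (h2 p hp hD) hns⟩
  · push Not at hw
    obtain ⟨j0, hj0⟩ := hw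
    refine ⟨fun _ => 1, fun _ => ⟨0, (by intro e he; simp at he), by simp [evalCoeff]⟩,
      fun g hg _ hcb _ => ?_⟩
    obtain ⟨j1, j2, h01, h02, h12, hall⟩ := aux_three j0
    have hL : ∃ e ∈ g.support, e (Sum.inr j0) ≠ 0 := by
      by_contra hcon
      push Not at hcon
      exact aux_not_cone (by omega) hg hcb.terminal.2 j0 j1 j2 h01 h02 hall h12 hcon
    have hint := hcb.integral
    have hdom : IsDomain (coneRing ℂ g) := (Ideal.Quotient.isDomain_iff_prime _).2 hint
    let τ : Cox ℂ n 3 →ₐ[ℂ] FractionRing (coneRing ℂ g) :=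
      (IsScalarTower.toAlgHom ℂ (coneRing ℂ g) (FractionRing (coneRing ℂ g))).comp
        (Ideal.Quotient.mkₐ ℂ _)
    have hker : ∀ p, τ p = 0 ↔ g ∣ p := by
      intro p
      rw [← Ideal.mem_span_singleton, ← Ideal.Quotient.eq_zero_iff_mem]
      exact map_eq_zero_iff _ (IsFractionRing.injective (coneRing ℂ g) (FractionRing (coneRing ℂ g)))
    exact ⟨n, aux_rational ⟨0, by omega⟩ hg τ hker j0 j1 j2 h01 h02 h12 hall hj0 hL⟩

end ConicBundleFormalization
end

section
/- Let π : X → ℙ^{n−1} be an embedded conic bundle over ℂ with n ≥ 3. If X is general in its linear system and X is singular, then X is rational. -/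
/-!
Formalization framework for "Stable rationality of higher dimensional conic bundles"
(Ahmadinezhad–Okada).

We model a weighted-projective-space bundle `P` over `ℙ^{n-1}` (in particular the
`ℙ²`-bundle `P_n(k,l,m) = ℙ(𝒪(-k) ⊕ 𝒪(-l) ⊕ 𝒪(-m))`, and the `ℙ(1,1,2)`-bundle `R`)
through its Cox ring `K[u_0,…,u_{n-1}, x_0,…,x_{m-1}]`, bigraded by
`deg u_i = (1,0)`, `deg x_j = (w j, a j)`, together with the action of the
two-dimensional torus on the affine cone.  A member `X` of the complete linear
system `|𝒪_P(α,β)| = |α F + β D|` (`F` the pullback of the hyperplane class of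
`ℙ^{n-1}`, `D` the tautological class) is recorded by a bihomogeneous polynomial
`g` of bidegree `(α,β)`, and the projection `π : X → ℙ^{n-1}` is induced by the
coordinates `u_0,…,u_{n-1}`.

Geometric notions are rendered as follows (all are genuine definitions):

* a *general* (resp. *very general*) member of a linear system: the property holds
  on a nonempty principal Zariski-open subset of the parameter space (resp. away
  from countably many proper closed subsets);
* smoothness of `X`: the Jacobian criterion on the punctured affine cone (where the
  torus acts freely the quotient map is a torsor, so this is smoothness of `X`);
* the function field `K(X)`: the degree-`(0,0)` part of the fraction field of the
  homogeneous coordinate ring `Cox/(g)`, i.e. the subalgebra generated by ratios of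
  bihomogeneous elements of equal bidegree;
* rationality: `K(X)` is `K`-isomorphic to a purely transcendental extension of
  `K` (i.e. `X` is birational to a projective space);
* stable rationality: `K(X)(x_1,…,x_r) ≅_K K(y_1,…,y_s)` for some `r,s`
  (i.e. `X × ℙ^r` is birational to a projective space);
* normality: the local rings of the relevant locus of the affine cone are
  integrally closed (the punctured cone is a smooth torsor over `X`);
* terminal singularities: rendered as `X` normal with singular locus of
  codimension at least 3, which is the form terminality takes for the general
  members appearing in the paper;
* ℚ-factoriality together with `ρ(X) = 2` (i.e. the divisor class group of `X` is
  spanned up to torsion by the fibre class `F` and the tautological class `D`):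
  rendered by requiring every relevant bihomogeneous height-one prime `P` of the
  coordinate ring of `X` to contain a bihomogeneous element lying in no other such
  prime (so that `div(f) = k·P` and `[P] ∈ ℚ⟨F, D⟩`);
* ampleness of `𝒪_X(α,β)`: some multiple is very ample, rendered by requiring the
  bihomogeneous sections of that multiple to be base point free, to separate
  points, and to separate tangent vectors (modulo the torus directions) on the
  cone over `X`;
* `π`-ampleness of `-K_X`: by adjunction `-K_X = 𝒪_X(e,1)` with
  `e = n + Σ w - deg g`, and relative ampleness over the projective base means
  some twist `𝒪_X(e+N,1)` by pullback classes from `ℙ^{n-1}` is ample;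
* connectedness of the fibres of `π : X → ℙ^{n-1}`: no fibre admits a disjoint
  covering by two zero sets of families of weighted-homogeneous polynomials, each
  meeting the fibre (i.e. Zariski-connectedness of the fibres), and all fibres are
  nonempty;
* a conic bundle (Mori fibre space of relative dimension one, Definition 2.5 of
  the paper): `X` is irreducible (the ideal of `g` is prime), normal, has only
  terminal singularities, `π` has connected fibres, `-K_X` is `π`-ample, and
  `ρ(X) = 2`; all in the above renderings.
-/

open MvPolynomial

set_option maxHeartbeats 1600000
set_option synthInstance.maxHeartbeats 400000

namespace ConicBundleFormalization

open MvPolynomial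


theorem cbAux_chart {σ : Type} [Fintype σ] [DecidableEq σ] {K : Type} [Field K] [Infinite K]
    (S : Finset (σ →₀ ℕ)) (V : Finset σ) (b : σ → K)
    (r : Option V → σ →₀ ℕ) (hr : ∀ t, ∀ x, r t x ≠ 0 → x ∉ V ∧ b x = 1)
    (m : Option V → S) (hm0 : (m none : σ →₀ ℕ) = r none)
    (hm : ∀ v : V, (m (some v) : σ →₀ ℕ) = Finsupp.single (v : σ) 1 + r (some v)) :
    ∃ D : MvPolynomial (σ →₀ ℕ) K,
      (∃ p0 : MvPolynomial σ K, p0.support ⊆ S ∧ eval (fun e => p0.coeff e) D ≠ 0) ∧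
      ∀ g : MvPolynomial σ K, g.support ⊆ S → ∀ p : σ → K, (∀ x, x ∉ V → p x = b x) →
        eval p g = 0 → (∀ v ∈ V, eval p (pderiv v g) = 0) →
        eval (fun e => g.coeff e) D = 0 := by
  classical
  have hrV : ∀ t, ∀ v ∈ V, r t v = 0 := fun t v hv => by
    by_contra h; exact (hr t v h).1 hv
  have hminj : Function.Injective m := by
    intro t t' h
    have h' : (m t : σ →₀ ℕ) = m t' := by rw [h]
    rcases t with _ | v <;> rcases t' with _ | v'
    · rfl
    · rw [hm0, hm] at h'
      have := DFunLike.congr_fun h' (v' : σ)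
      simp [hrV _ _ v'.2] at this
    · rw [hm0, hm] at h'
      have := DFunLike.congr_fun h' (v : σ)
      simp [hrV _ _ v.2] at this
    · rw [hm, hm] at h'
      have := DFunLike.congr_fun h' (v : σ)
      simp only [Finsupp.add_apply, hrV _ _ v.2, Finsupp.single_apply] at this
      by_contra hne
      have : (v' : σ) ≠ v := fun h => hne (by rw [Subtype.ext h])
      simp_all
  let R : Type := ((Set.range m)ᶜ : Set S)
  let A := MvPolynomial (V ⊕ R) K
  let P : σ → A := fun x => if h : x ∈ V then X (Sum.inl ⟨x, h⟩) else C (b x)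
  let G0 : MvPolynomial σ A := ∑ s : R, monomial (s.1 : σ →₀ ℕ) (X (Sum.inr s))
  let γs : V → A := fun v => - eval P (pderiv (v : σ) G0)
  let γ : Option V → A := fun t => t.elim (- eval P G0 - ∑ v : V, P v * γs v) γs
  let c : S → A := fun s => if h : ∃ t, m t = s then γ h.choose else
    X (Sum.inr ⟨s, by simpa using h⟩)
  have hcm : ∀ t, c (m t) = γ t := by
    intro t
    have h : ∃ t', m t' = m t := ⟨t, rfl⟩
    have : c (m t) = γ h.choose := dif_pos h
    rw [this, hminj h.choose_spec]
  have hcr : ∀ s : R, c s.1 = X (Sum.inr s) := by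
    intro s
    have h : ¬ ∃ t, m t = s.1 := s.2
    exact dif_neg h
  have hnot : ¬ AlgebraicIndependent K c := by
    intro h
    have h1 := h.cardinalMk_le_trdeg
    rw [MvPolynomial.trdeg_of_isDomain] at h1
    have h2 : Fintype.card R + (Fintype.card V + 1) = Fintype.card S := by
      have e1 : Fintype.card R = Fintype.card S - Fintype.card (Set.range m) :=
        Fintype.card_compl_set (Set.range m)
      have e2 : Fintype.card (Set.range m) = Fintype.card V + 1 := by
        rw [Set.card_range_of_injective hminj, Fintype.card_option]
      have e3 : Fintype.card (Set.range m) ≤ Fintype.card S := by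
        exact Fintype.card_subtype_le _
      omega
    simp only [Cardinal.lift_id, Cardinal.mk_fintype, Fintype.card_sum] at h1
    have h1 := Nat.cast_le.mp h1
    omega
  rw [algebraicIndependent_iff] at hnot
  push Not at hnot
  obtain ⟨D', hD0, hDne⟩ := hnot
  have hne : ∃ cc : S → K, eval cc D' ≠ 0 := by
    by_contra! h
    exact hDne (MvPolynomial.funext (fun x => by simpa using h x))
  refine ⟨rename Subtype.val D', ?_, ?_⟩
  · obtain ⟨cc, hcc⟩ := hne
    refine ⟨∑ s : S, monomial (s : σ →₀ ℕ) (cc s), ?_, ?_⟩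
    · intro e he
      by_contra hS
      rw [mem_support_iff, coeff_sum] at he
      refine he (Finset.sum_eq_zero fun s _ => ?_)
      rw [coeff_monomial, if_neg]
      rintro rfl
      exact hS s.2
    · rw [eval_rename]
      convert hcc using 2
      congr 1
      funext s
      simp only [Function.comp, coeff_sum, coeff_monomial]
      rw [Finset.sum_eq_single s]
      · simp
      · intro t _ ht
        rw [if_neg (fun h => ht (Subtype.ext h))]
      · simp
  · intro g hg p hp h0 h1
    rw [eval_rename]
    let ψ : A →ₐ[K] K := aeval (Sum.elim (fun v : V => p v) (fun s : R => g.coeff s.1))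
    have hψX : ∀ y, ψ (X y) = Sum.elim (fun v : V => p v) (fun s : R => g.coeff s.1) y :=
      fun y => aeval_X _ y
    have hψC : ∀ y, ψ (C y) = y := fun y => aeval_C _ y
    have hψP : ∀ x, ψ (P x) = p x := by
      intro x
      by_cases h : x ∈ V
      · simp [P, h, hψX]
      · simp [P, h, hψC, hp x h]
    let g0 : MvPolynomial σ K := ∑ s : R, monomial (s.1 : σ →₀ ℕ) (g.coeff s.1)
    have hG0 : MvPolynomial.map (ψ : A →+* K) G0 = g0 := by
      simp [G0, g0, map_sum, map_monomial, hψX]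
    have hev : ∀ F : MvPolynomial σ A, ψ (eval P F) = eval p (MvPolynomial.map (ψ : A →+* K) F) := by
      intro F
      rw [eval_map, ← RingHom.coe_coe (ψ), MvPolynomial.eval, coe_eval₂Hom, hom_eval₂]
      congr 1
      funext x
      exact hψP x
    have hgdec : g = g0 + ∑ t, monomial (m t : σ →₀ ℕ) (g.coeff (m t)) := by
      ext e
      have hsum : g = ∑ s : S, monomial (s : σ →₀ ℕ) (g.coeff s) := by
        conv_lhs => rw [g.as_sum]
        rw [Finset.sum_subset hg]
        · rw [← Finset.sum_coe_sort S]
        · intro e _ he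
          rw [notMem_support_iff.mp he]; simp
      have : (∑ s : S, monomial (s : σ →₀ ℕ) (g.coeff s)) = g0 + ∑ t, monomial (m t : σ →₀ ℕ) (g.coeff (m t)) := by
        rw [← Finset.sum_compl_add_sum (Finset.univ.image m)]
        congr 1
        · simp only [g0]
          rw [← Finset.sum_subtype (p := fun s : S => s ∈ (Set.range m)ᶜ) (f := fun s : S => monomial (s : σ →₀ ℕ) (g.coeff s))]
          intro x; simp
        · rw [Finset.sum_image (fun _ _ _ _ h => hminj h)]
      rw [← this, ← hsum]
    have hprod : ∀ t, (r t).prod (fun i k => p i ^ k) = 1 := by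
      intro t
      refine Finset.prod_eq_one fun x hx => ?_
      have := hr t x (Finsupp.mem_support_iff.mp hx)
      simp [hp x this.1, this.2]
    have hev0 : eval p (monomial (m none : σ →₀ ℕ) (g.coeff (m none))) = g.coeff (m none) := by
      rw [hm0, eval_monomial, hprod, mul_one]
    have hevv : ∀ v : V, eval p (monomial (m (some v) : σ →₀ ℕ) (g.coeff (m (some v)))) = g.coeff (m (some v)) * p v := by
      intro v
      rw [hm v, eval_monomial, Finsupp.prod_add_index' (by simp) (by simp [pow_add]), hprod]
      simp
    have hd : ∀ (v : V) t, eval p (pderiv (v : σ) (monomial (m t : σ →₀ ℕ) (g.coeff (m t)))) =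
        if t = some v then g.coeff (m t) else 0 := by
      intro v t
      rw [pderiv_monomial]
      rcases t with _ | v'
      · rw [hm0, hrV _ _ v.2]; simp
      · by_cases hvv : v' = v
        · subst hvv
          rw [hm v', eval_monomial]
          simp [hrV _ _ v'.2, hprod]
        · have : (v' : σ) ≠ v := fun h => hvv (Subtype.ext h)
          rw [hm v']
          simp [hrV _ _ v.2, hvv, this]
    have hγs : ∀ v : V, ψ (γs v) = g.coeff (m (some v)) := by
      intro v
      have := h1 v v.2
      rw [hgdec] at this
      simp only [map_add, map_sum, hd] at this
      simp only [γs, map_neg]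
      rw [hev, ← pderiv_map, hG0]
      simp at this
      linear_combination -this
    have hγ0 : ψ (γ none) = g.coeff (m none) := by
      have := h0
      rw [hgdec] at this
      simp only [map_add, map_sum, Fintype.sum_option, hev0, hevv] at this
      simp only [γ, Option.elim, map_sub, map_neg, map_sum, map_mul, hγs, hψP]
      rw [hev, hG0]
      simp only [mul_comm (p _)]
      linear_combination -this
    have hc : ∀ s : S, ψ (c s) = g.coeff s := by
      intro s
      by_cases h : ∃ t, m t = s
      · obtain ⟨t, rfl⟩ := h
        rw [hcm]
        rcases t with _ | v
        · exact hγ0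
        · exact hγs v
      · have := hcr ⟨s, by simpa using h⟩
        simp only at this
        rw [this, hψX]
        rfl
    have := congrArg ψ hD0
    rw [map_zero, ← AlgHom.comp_apply, comp_aeval] at this
    rw [← this, ← MvPolynomial.coe_aeval_eq_eval]
    simp only [hc, Function.comp_def]
    rfl

/-- first weight -/
def cbWt {n : ℕ} (w : Fin 3 → ℤ) : Fin n ⊕ Fin 3 → ℤ := Sum.elim (fun _ => 1) w
/-- second weight -/
def cbBt {n : ℕ} : Fin n ⊕ Fin 3 → ℕ := Sum.elim (fun _ => 0) (fun _ => 1)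

theorem cb_bihom_iff {K : Type} [Field K] {n : ℕ} (w : Fin 3 → ℤ) (α : ℤ) (β : ℕ) (p : Cox K n 3) :
    IsBihom K n 3 w (fun _ => 1) α β p ↔
      ∀ e ∈ p.support, ∑ v, (e v : ℤ) * cbWt w v = α ∧ ∑ v, e v * cbBt v = β := by
  simp [IsBihom, cbWt, cbBt]

theorem cb_bihom_iff' {K : Type} [Field K] {n : ℕ} (w : Fin 3 → ℤ) (α : ℤ) (β : ℕ) (p : Cox K n 3) :
    IsBihom K n 3 w (fun _ => 1) α β p ↔
      IsWeightedHomogeneous (fun v => (cbWt w v, cbBt v)) p (α, β) := by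
  rw [cb_bihom_iff]
  unfold IsWeightedHomogeneous
  simp only [mem_support_iff]
  refine forall_congr' fun e => imp_congr_right fun _ => ?_
  rw [Finsupp.weight_apply, Finsupp.sum_fintype _ _ (by simp), Prod.ext_iff]
  simp [Prod.fst_sum, Prod.snd_sum]

theorem cb_zpow_sum {F : Type} [Field F] {ι : Type} (s : Finset ι) (U : F) (hU : U ≠ 0) (a : ι → ℤ) :
    ∏ i ∈ s, U ^ a i = U ^ (∑ i ∈ s, a i) := by
  classical
  induction s using Finset.induction_on with
  | empty => simp
  | insert i s hi ih => rw [Finset.prod_insert hi, Finset.sum_insert hi, zpow_add₀ hU, ih]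

theorem cb_scale {K F : Type} [Field K] [Field F] [Algebra K F] {n : ℕ} (w : Fin 3 → ℤ)
    (U W : F) (hU : U ≠ 0) (z ζ : Fin n ⊕ Fin 3 → F)
    (hz : ∀ v, z v = U ^ cbWt w v * W ^ cbBt v * ζ v)
    (α : ℤ) (β : ℕ) (p : Cox K n 3) (hp : IsBihom K n 3 w (fun _ => 1) α β p) :
    aeval z p = U ^ α * W ^ β * aeval ζ p := by
  rw [cb_bihom_iff] at hp
  simp only [aeval_def, eval₂_eq']
  rw [Finset.mul_sum]
  refine Finset.sum_congr rfl fun e he => ?_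
  obtain ⟨h1, h2⟩ := hp e he
  have : ∏ i, z i ^ e i = U ^ α * W ^ β * ∏ i, ζ i ^ e i := by
    rw [← h1, ← h2, ← cb_zpow_sum _ U hU, ← Finset.prod_pow_eq_pow_sum, ← Finset.prod_mul_distrib,
      ← Finset.prod_mul_distrib]
    refine Finset.prod_congr rfl fun v _ => ?_
    rw [hz v, mul_pow, mul_pow, ← zpow_natCast (U ^ _), ← zpow_mul, ← pow_mul, mul_comm (cbWt w v),
      mul_comm (cbBt v)]
  rw [this]; ring

theorem cb_sum_single_int {ι : Type} [Fintype ι] (a : ι) (c : ℕ) (f : ι → ℤ) :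
    ∑ v, ((Finsupp.single a c v : ℕ) : ℤ) * f v = c * f a := by
  classical
  rw [Finset.sum_eq_single a]
  · simp
  · intro b _ hb; simp [Finsupp.single_apply, Ne.symm hb]
  · simp

theorem cb_sum_single_nat {ι : Type} [Fintype ι] (a : ι) (c : ℕ) (f : ι → ℕ) :
    ∑ v, Finsupp.single a c v * f v = c * f a := by
  classical
  rw [Finset.sum_eq_single a]
  · simp
  · intro b _ hb; simp [Finsupp.single_apply, Ne.symm hb]
  · simp

theorem cb_rat {K F : Type} [Field K] [Field F] [Algebra K F] {n : ℕ} (w : Fin 3 → ℤ) (d : ℤ)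
    (g : Cox K n 3) (τ : Cox K n 3 →ₐ[K] F) (hker : ∀ f, τ f = 0 ↔ g ∣ f)
    (hb : IsBihom K n 3 w (fun _ => 1) d 2 g) (j k : Fin 3) (hkj : k ≠ j) (i0 : Fin n)
    (hle : ∀ e ∈ g.support, e (Sum.inr j) ≤ 1) (hex : ∃ e ∈ g.support, e (Sum.inr j) = 1) :
    ∃ N : ℕ, Nonempty (Algebra.adjoin K {φ : F | ∃ (α : ℤ) (β : ℕ) (p q : Cox K n 3),
      IsBihom K n 3 w (fun _ => 1) α β p ∧ IsBihom K n 3 w (fun _ => 1) α β q ∧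
      τ q ≠ 0 ∧ φ * τ q = τ p} ≃ₐ[K] FractionRing (MvPolynomial (Fin N) K)) := by
  classical
  have hg0 : g ≠ 0 := by rintro rfl; simp at hex
  have hinj : ∀ f : Cox K n 3, (∀ e ∈ f.support, e (Sum.inr j) = 0) → τ f = 0 → f = 0 := by
    intro f hf hτ
    obtain ⟨h, rfl⟩ := (hker f).1 hτ
    by_contra hne
    have hh : h ≠ 0 := right_ne_zero_of_mul hne
    have h1 := degreeOf_mul_eq (n := (Sum.inr j : Fin n ⊕ Fin 3)) hg0 hh
    have h2 : degreeOf (Sum.inr j) (g * h) ≤ 0 := by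
      rw [degreeOf_le_iff]; intro e he; exact (hf e he).le
    obtain ⟨e, he, he1⟩ := hex
    have h3 := monomial_le_degreeOf (Sum.inr j) he
    omega
  have hXne : ∀ v : Fin n ⊕ Fin 3, v ≠ Sum.inr j → τ (X v) ≠ 0 := by
    intro v hv h
    refine X_ne_zero (R := K) v (hinj _ ?_ h)
    intro e he
    rw [support_X, Finset.mem_singleton] at he
    subst he
    simp [Finsupp.single_apply, hv]
  set U := τ (X (Sum.inl i0)) with hUdef
  have hU : U ≠ 0 := hXne _ (by simp)
  set Xk := τ (X (Sum.inr k)) with hXkdef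
  have hXk : Xk ≠ 0 := hXne _ (by simpa using hkj)
  set W := Xk * U ^ (- w k) with hWdef
  have hW : W ≠ 0 := mul_ne_zero hXk (zpow_ne_zero _ hU)
  let ζ : Fin n ⊕ Fin 3 → F := fun v => τ (X v) / (U ^ cbWt w v * W ^ cbBt v)
  have hbih : ∀ α β f, IsBihom K n 3 w (fun _ => 1) α β f → τ f = U ^ α * W ^ β * aeval ζ f := by
    intro α β f hf
    conv_lhs => rw [aeval_unique τ]
    refine cb_scale w U W hU _ ζ (fun v => ?_) α β f hf
    have : U ^ cbWt w v * W ^ cbBt v ≠ 0 := mul_ne_zero (zpow_ne_zero _ hU) (pow_ne_zero _ hW)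
    simp only [ζ, Function.comp]
    rw [mul_div_cancel₀ _ this]
  have hbih0 : ∀ α β f, IsBihom K n 3 w (fun _ => 1) α β f → (aeval ζ f = 0 ↔ τ f = 0) := by
    intro α β f hf
    rw [hbih α β f hf]
    simp [zpow_ne_zero _ hU, hW]
  have hζi : ζ (Sum.inl i0) = 1 := by
    simp [ζ, cbWt, cbBt, ← hUdef, hU]
  have hζk : ζ (Sum.inr k) = 1 := by
    simp only [ζ, cbWt, cbBt, Sum.elim_inr, ← hXkdef, pow_one, W]
    rw [mul_left_comm, ← zpow_add₀ hU]
    simp [hXk]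
  let V' := {v : Fin n ⊕ Fin 3 // v ≠ Sum.inl i0 ∧ v ≠ Sum.inr k ∧ v ≠ Sum.inr j}
  let ζ' : V' → F := fun v => ζ v.1
  have hind : AlgebraicIndependent K ζ' := by
    rw [algebraicIndependent_iff]
    intro f hf
    let f' : Cox K n 3 := rename Subtype.val f
    have hf' : aeval ζ f' = 0 := by
      rw [aeval_rename]; exact hf
    have hsupp : ∀ e ∈ f'.support, e (Sum.inl i0) = 0 ∧ e (Sum.inr k) = 0 ∧ e (Sum.inr j) = 0 := by
      intro e he
      have hz : ∀ v : Fin n ⊕ Fin 3, ¬ (v ≠ Sum.inl i0 ∧ v ≠ Sum.inr k ∧ v ≠ Sum.inr j) → e v = 0 := by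
        intro v hv
        by_contra hev
        obtain ⟨u, hu1, hu2⟩ := coeff_rename_ne_zero _ _ _ (mem_support_iff.1 he)
        rw [← hu1, Finsupp.mapDomain_of_notMem_range] at hev
        · exact hev rfl
        · rintro ⟨x, rfl⟩; exact hv x.2
      refine ⟨hz _ (by simp), hz _ (by simp), hz _ (by simp)⟩
    let aa : ((Fin n ⊕ Fin 3) →₀ ℕ) → ℤ := fun e => ∑ v, (e v : ℤ) * cbWt w v
    let bb : ((Fin n ⊕ Fin 3) →₀ ℕ) → ℕ := fun e => ∑ v, e v * cbBt v
    let M : ℕ := ∑ e ∈ f'.support, bb e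
    let cc : ((Fin n ⊕ Fin 3) →₀ ℕ) → ℤ := fun e => aa e + w k * ((M - bb e : ℕ) : ℤ)
    let N : ℤ := ∑ e ∈ f'.support, |cc e|
    let hh : ((Fin n ⊕ Fin 3) →₀ ℕ) → ((Fin n ⊕ Fin 3) →₀ ℕ) := fun e =>
      e + Finsupp.single (Sum.inl i0) (N - cc e).toNat + Finsupp.single (Sum.inr k) (M - bb e)
    have hM : ∀ e ∈ f'.support, bb e ≤ M := fun e he =>
      Finset.single_le_sum (f := bb) (fun _ _ => Nat.zero_le _) he
    have hN : ∀ e ∈ f'.support, cc e ≤ N := fun e he =>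
      (le_abs_self _).trans (Finset.single_le_sum (f := fun e => |cc e|) (fun _ _ => abs_nonneg _) he)
    let G : Cox K n 3 := ∑ e ∈ f'.support, monomial (hh e) (f'.coeff e)
    have hGsupp : ∀ e' ∈ G.support, ∃ e ∈ f'.support, e' = hh e := by
      intro e' he'
      have := Finset.mem_biUnion.1 (support_sum he')
      obtain ⟨e, he, h⟩ := this
      have := support_monomial_subset h
      exact ⟨e, he, by simpa using this⟩
    have hGb : IsBihom K n 3 w (fun _ => 1) N M G := by
      rw [cb_bihom_iff]
      intro e' he'
      obtain ⟨e, he, rfl⟩ := hGsupp e' he'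
      have h1 := hM e he
      have h2 := hN e he
      simp only [hh, Finsupp.add_apply, Nat.cast_add, add_mul, Finset.sum_add_distrib]
      have h3 : aa e = ∑ x : Fin n ⊕ Fin 3, (e x : ℤ) * cbWt w x := rfl
      have h4 : bb e = ∑ x : Fin n ⊕ Fin 3, e x * cbBt x := rfl
      rw [cb_sum_single_int, cb_sum_single_int, cb_sum_single_nat, cb_sum_single_nat, ← h3, ← h4]
      simp only [cbWt, cbBt, Sum.elim_inl, Sum.elim_inr]
      constructor
      · rw [Int.toNat_of_nonneg (by omega)]
        simp only [cc]
        ring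
      · omega
    have hGz : aeval ζ G = 0 := by
      rw [← hf']
      conv_rhs => rw [f'.as_sum]
      simp only [G, map_sum]
      refine Finset.sum_congr rfl fun e he => ?_
      rw [aeval_monomial, aeval_monomial]
      congr 1
      simp only [hh]
      rw [Finsupp.prod_add_index' (by simp) (by simp [pow_add]),
        Finsupp.prod_add_index' (by simp) (by simp [pow_add])]
      rw [Finsupp.prod_single_index (by simp), Finsupp.prod_single_index (by simp), hζi, hζk]
      simp
    have hG0 : G = 0 := by
      refine hinj G ?_ ((hbih0 _ _ _ hGb).1 hGz)
      intro e' he'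
      obtain ⟨e, he, rfl⟩ := hGsupp e' he'
      simp [hh, (hsupp e he).2.2, Finsupp.single_apply, hkj]
    have hf'0 : f' = 0 := by
      by_contra hne
      obtain ⟨e, he⟩ := Finset.nonempty_iff_ne_empty.2 (fun h => hne (support_eq_empty.1 h))
      have h1 : G.coeff (hh e) = f'.coeff e := by
        simp only [G, coeff_sum, coeff_monomial]
        rw [Finset.sum_eq_single e]
        · simp
        · intro e2 he2 hne2
          rw [if_neg]
          intro hhe
          apply hne2
          ext v
          have := DFunLike.congr_fun hhe v
          by_cases hv1 : v = Sum.inl i0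
          · rw [hv1, (hsupp e he).1, (hsupp e2 he2).1]
          by_cases hv2 : v = Sum.inr k
          · rw [hv2, (hsupp e he).2.1, (hsupp e2 he2).2.1]
          simpa [hh, Finsupp.single_apply, Ne.symm hv1, Ne.symm hv2] using this
        · intro h; exact absurd he h
      rw [hG0, coeff_zero] at h1
      exact (mem_support_iff.1 he) h1.symm
    exact rename_injective _ Subtype.val_injective (by simpa [f'] using hf'0)
  let E := IntermediateField.adjoin K (Set.range ζ')
  have hE0 : ∀ v, v ≠ Sum.inr j → ζ v ∈ E := by
    intro v hv
    by_cases h1 : v = Sum.inl i0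
    · rw [h1, hζi]; exact one_mem _
    by_cases h2 : v = Sum.inr k
    · rw [h2, hζk]; exact one_mem _
    exact IntermediateField.subset_adjoin _ _ ⟨⟨v, h1, h2, hv⟩, rfl⟩
  have hE1 : ∀ f : Cox K n 3, (∀ e ∈ f.support, ∀ v, e v ≠ 0 → ζ v ∈ E) → aeval ζ f ∈ E := by
    intro f hf
    rw [aeval_def, eval₂_eq']
    refine sum_mem fun e he => mul_mem (E.algebraMap_mem _) (prod_mem fun v _ => ?_)
    by_cases h : e v = 0
    · rw [h, pow_zero]; exact one_mem _
    · exact pow_mem (hf e he v h) _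
  have hEj : ζ (Sum.inr j) ∈ E := by
    let s : (Fin n ⊕ Fin 3) →₀ ℕ := Finsupp.single (Sum.inr j) 1
    let l := g.divMonomial s
    let q := g.modMonomial s
    have hdec : X (Sum.inr j) * l + q = g := divMonomial_add_modMonomial_single g (Sum.inr j)
    have hlg : ∀ e ∈ l.support, s + e ∈ g.support := by
      intro e he
      rw [mem_support_iff, coeff_divMonomial] at he
      exact mem_support_iff.2 he
    have hl0 : ∀ e ∈ l.support, e (Sum.inr j) = 0 := by
      intro e he
      have := hle _ (hlg e he)
      simp only [s, Finsupp.add_apply, Finsupp.single_eq_same] at this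
      omega
    have hq0 : ∀ e ∈ q.support, e (Sum.inr j) = 0 := by
      intro e he
      by_contra hne
      refine mem_support_iff.1 he (coeff_modMonomial_of_le _ ?_)
      simp only [s]
      rw [Finsupp.single_le_iff]; omega
    have hlb : IsBihom K n 3 w (fun _ => 1) (d - w j) 1 l := by
      rw [cb_bihom_iff] at hb ⊢
      intro e he
      obtain ⟨h1, h2⟩ := hb _ (hlg e he)
      simp only [s, Finsupp.add_apply, Nat.cast_add, add_mul, Finset.sum_add_distrib] at h1 h2
      rw [Finset.sum_eq_single (Sum.inr j : Fin n ⊕ Fin 3)] at h1 h2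
      · simp only [Finsupp.single_eq_same] at h1 h2
        have e1 : cbWt (n := n) w (Sum.inr j) = w j := rfl
        have e2 : cbBt (n := n) (Sum.inr j) = 1 := rfl
        rw [e1] at h1
        rw [e2] at h2
        constructor
        · push_cast at h1; linarith
        · omega
      · intro b _ hb; simp [Finsupp.single_apply, Ne.symm hb]
      · simp
      · intro b _ hb; simp [Finsupp.single_apply, Ne.symm hb]
      · simp
    have hlne : l ≠ 0 := by
      obtain ⟨e, he, he1⟩ := hex
      intro h
      have : coeff (e - s) l = coeff e g := by
        simp only [l]
        rw [coeff_divMonomial, add_tsub_cancel_of_le]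
        simp only [s]
        rw [Finsupp.single_le_iff]; omega
      rw [h, coeff_zero] at this
      exact mem_support_iff.1 he this.symm
    have hl1 : aeval ζ l ≠ 0 := by
      intro h
      exact hlne (hinj l hl0 ((hbih0 _ _ _ hlb).1 h))
    have hg1 : aeval ζ g = 0 := (hbih0 _ _ _ hb).2 ((hker g).2 dvd_rfl)
    rw [← hdec] at hg1
    simp only [map_add, map_mul, aeval_X] at hg1
    have : ζ (Sum.inr j) = - aeval ζ q / aeval ζ l := by
      field_simp
      linear_combination hg1
    rw [this]
    refine div_mem (neg_mem (hE1 _ ?_)) (hE1 _ ?_)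
    · intro e he v hv
      refine hE0 v ?_
      rintro rfl; exact hv (hq0 e he)
    · intro e he v hv
      refine hE0 v ?_
      rintro rfl; exact hv (hl0 e he)
  have hEall : ∀ f : Cox K n 3, aeval ζ f ∈ E := by
    intro f
    refine hE1 f fun e _ v _ => ?_
    by_cases h : v = Sum.inr j
    · rw [h]; exact hEj
    · exact hE0 v h
  set RS : Set F := {φ : F | ∃ (α : ℤ) (β : ℕ) (p q : Cox K n 3),
      IsBihom K n 3 w (fun _ => 1) α β p ∧ IsBihom K n 3 w (fun _ => 1) α β q ∧
      τ q ≠ 0 ∧ φ * τ q = τ p} with hRS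
  have hadj : ∀ x ∈ Algebra.adjoin K RS, x ∈ RS := by
    intro x hx
    induction hx using Algebra.adjoin_induction with
    | mem x hx => exact hx
    | algebraMap r =>
      refine ⟨0, 0, C r, 1, ?_, ?_, by simp, ?_⟩
      · rw [cb_bihom_iff']; exact isWeightedHomogeneous_C _ r
      · rw [cb_bihom_iff']; exact isWeightedHomogeneous_one _ _
      · rw [map_one, mul_one, ← algebraMap_eq, AlgHom.commutes]
    | add x y _ _ hx hy =>
      obtain ⟨α, β, p, q, hp, hq, hq0, h⟩ := hx
      obtain ⟨α', β', p', q', hp', hq', hq0', h'⟩ := hy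
      rw [cb_bihom_iff'] at hp hq hp' hq'
      refine ⟨α + α', β + β', p * q' + q * p', q * q', ?_, ?_, ?_, ?_⟩
      · rw [cb_bihom_iff']; exact (hp.mul hq').add (hq.mul hp')
      · rw [cb_bihom_iff']; exact hq.mul hq'
      · rw [map_mul]; exact mul_ne_zero hq0 hq0'
      · simp only [map_mul, map_add]; rw [← h, ← h']; ring
    | mul x y _ _ hx hy =>
      obtain ⟨α, β, p, q, hp, hq, hq0, h⟩ := hx
      obtain ⟨α', β', p', q', hp', hq', hq0', h'⟩ := hy
      rw [cb_bihom_iff'] at hp hq hp' hq'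
      refine ⟨α + α', β + β', p * p', q * q', ?_, ?_, ?_, ?_⟩
      · rw [cb_bihom_iff']; exact hp.mul hp'
      · rw [cb_bihom_iff']; exact hq.mul hq'
      · rw [map_mul]; exact mul_ne_zero hq0 hq0'
      · simp only [map_mul]; rw [← h, ← h']; ring
  have hinv : ∀ x ∈ Algebra.adjoin K RS, x⁻¹ ∈ Algebra.adjoin K RS := by
    intro x hx
    by_cases hx0 : x = 0
    · rw [hx0, inv_zero]; exact zero_mem _
    obtain ⟨α, β, p, q, hp, hq, hq0, h⟩ := hadj x hx
    refine Algebra.subset_adjoin ⟨α, β, q, p, hq, hp, ?_, ?_⟩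
    · rw [← h]; exact mul_ne_zero hx0 hq0
    · rw [← h, inv_mul_cancel_left₀ hx0]
  have hEq : Algebra.adjoin K RS = E.toSubalgebra := by
    apply le_antisymm
    · refine Algebra.adjoin_le ?_
      rintro φ ⟨α, β, p, q, hp, hq, hq0, h⟩
      have hq1 : aeval ζ q ≠ 0 := fun h => hq0 ((hbih0 _ _ _ hq).1 h)
      rw [hbih _ _ _ hp, hbih _ _ _ hq] at h
      have hne : U ^ α * W ^ β ≠ 0 := mul_ne_zero (zpow_ne_zero _ hU) (pow_ne_zero _ hW)
      have : φ = aeval ζ p / aeval ζ q := by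
        rw [eq_div_iff hq1]
        apply mul_left_cancel₀ hne
        rw [← h]; ring
      rw [this]
      exact (div_mem (S := IntermediateField K F) (hEall p) (hEall q) : _ ∈ E)
    · have : E ≤ (Algebra.adjoin K RS).toIntermediateField hinv := by
        rw [IntermediateField.adjoin_le_iff]
        rintro _ ⟨⟨v, hv⟩, rfl⟩
        refine Algebra.subset_adjoin ?_
        rcases v with i | l
        · refine ⟨1, 0, X (Sum.inl i), X (Sum.inl i0), ?_, ?_, hU, ?_⟩
          · rw [cb_bihom_iff']; exact isWeightedHomogeneous_X _ _ _
          · rw [cb_bihom_iff']; exact isWeightedHomogeneous_X _ _ _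
          · simp only [ζ', ζ, cbWt, cbBt, Sum.elim_inl, zpow_one, pow_zero, mul_one]
            rw [← hUdef, div_mul_cancel₀ _ hU]
        · have hbX : ∀ (l : Fin 3) (a : ℕ), IsBihom K n 3 w (fun _ => 1) (w l + a) 1
              (X (Sum.inr l) * X (Sum.inl i0) ^ a) := by
            intro l a
            rw [cb_bihom_iff']
            have := (isWeightedHomogeneous_X K (fun v => (cbWt (n := n) w v, cbBt v)) (Sum.inr l)).mul
              ((isWeightedHomogeneous_X K (fun v => (cbWt (n := n) w v, cbBt v)) (Sum.inl i0)).pow a)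
            convert this using 1
            simp [cbWt, cbBt]
          refine ⟨w l + (w k - w l).toNat, 1, X (Sum.inr l) * X (Sum.inl i0) ^ (w k - w l).toNat,
            X (Sum.inr k) * X (Sum.inl i0) ^ (w l - w k).toNat, hbX _ _, ?_, ?_, ?_⟩
          · have := hbX k (w l - w k).toNat
            convert this using 1
            omega
          · simp only [map_mul, map_pow]
            exact mul_ne_zero hXk (pow_ne_zero _ hU)
          · simp only [map_mul, map_pow, ← hUdef, ← hXkdef, ζ', ζ, cbWt, cbBt, Sum.elim_inr, pow_one, W]
            have e1 : U ^ (w l) * U ^ (-w k) * U ^ ((w k - w l).toNat) = U ^ ((w l - w k).toNat) := by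
              rw [← zpow_natCast, ← zpow_natCast, ← zpow_add₀ hU, ← zpow_add₀ hU]
              congr 1
              omega
            have h1 := zpow_ne_zero (w l) hU
            have h2 := zpow_ne_zero (-w k) hU
            rw [← e1, div_mul_eq_mul_div, div_eq_iff (mul_ne_zero h1 (mul_ne_zero hXk h2))]
            ring
      exact this
  refine ⟨Fintype.card V', ?_⟩
  have eV := Fintype.equivFin V'
  have hind2 : AlgebraicIndependent K (ζ' ∘ eV.symm) := (algebraicIndependent_equiv eV.symm).2 hind
  have hEr : IntermediateField.adjoin K (Set.range (ζ' ∘ eV.symm)) = E := by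
    rw [EquivLike.range_comp]
  refine ⟨?_⟩
  refine (Subalgebra.equivOfEq _ _ hEq).trans ?_
  exact ((hind2.aevalEquivField).trans (IntermediateField.equivOfEq hEr)).symm


theorem cb_spanX_prime {σ K : Type} [Field K] (s : Set σ) :
    (Ideal.span ((X : σ → MvPolynomial σ K) '' s)).IsPrime := by
  classical
  let φ : MvPolynomial σ K →ₐ[K] MvPolynomial σ K := aeval (fun v => if v ∈ s then 0 else X v)
  have : Ideal.span ((X : σ → MvPolynomial σ K) '' s) = RingHom.ker φ.toRingHom := by
    apply le_antisymm
    · rw [Ideal.span_le]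
      rintro _ ⟨v, hv, rfl⟩
      simp [φ, RingHom.mem_ker, hv]
    · intro p hp
      have h : ∀ q : MvPolynomial σ K, q - φ q ∈ Ideal.span ((X : σ → MvPolynomial σ K) '' s) := by
        intro q
        induction q using MvPolynomial.induction_on with
        | C a => simp [φ, algebraMap_eq]
        | add p q hp hq =>
          rw [map_add, add_sub_add_comm]; exact add_mem hp hq
        | mul_X p v hp =>
          have e : p * X v - φ (p * X v) = (p - φ p) * X v + φ p * (X v - φ (X v)) := by
            rw [map_mul]; ring
          rw [e]
          refine add_mem (Ideal.mul_mem_right _ _ hp) (Ideal.mul_mem_left _ _ ?_)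
          by_cases hv : v ∈ s
          · simp only [φ, aeval_X, if_pos hv, sub_zero]
            exact Ideal.subset_span ⟨v, hv, rfl⟩
          · simp [φ, hv]
      have := h p
      have h0 : φ p = 0 := hp
      rwa [h0, sub_zero] at this
  rw [this]
  exact RingHom.ker_isPrime _

theorem cb_caseA (n : ℕ) (hn : 3 ≤ n) (w : Fin 3 → ℤ) (d : ℤ) (j : Fin 3) (hj : d < 2 * w j)
    (g : Cox ℂ n 3) (hg : IsConicBundleModel ℂ n w d g) : IsRationalModel ℂ w (fun _ => 1) g := by
  classical
  have hb := hg.bihom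
  have hdeg : ∀ e ∈ g.support, ∑ l : Fin 3, e (Sum.inr l) = 2 := by
    intro e he; simpa using (hb e he).2
  have hle : ∀ e ∈ g.support, e (Sum.inr j) ≤ 1 := by
    intro e he
    by_contra hc
    have h1 := (hb e he).1
    have h2 := hdeg e he
    have h3 : 0 ≤ ∑ i : Fin n, (e (Sum.inl i) : ℤ) := Finset.sum_nonneg fun _ _ => by positivity
    rw [Fin.sum_univ_three] at h1 h2
    fin_cases j <;> simp at hc h1 h2 hj
    · have a1 : e (Sum.inr 0) = 2 := by omega
      have a2 : e (Sum.inr 1) = 0 := by omega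
      have a3 : e (Sum.inr 2) = 0 := by omega
      rw [a1, a2, a3] at h1; push_cast at h1; linarith
    · have a1 : e (Sum.inr 1) = 2 := by omega
      have a2 : e (Sum.inr 0) = 0 := by omega
      have a3 : e (Sum.inr 2) = 0 := by omega
      rw [a1, a2, a3] at h1; push_cast at h1; linarith
    · have a1 : e (Sum.inr 2) = 2 := by omega
      have a2 : e (Sum.inr 0) = 0 := by omega
      have a3 : e (Sum.inr 1) = 0 := by omega
      rw [a1, a2, a3] at h1; push_cast at h1; linarith
  by_cases hex : ∃ e ∈ g.support, e (Sum.inr j) = 1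
  · haveI := hg.integral
    haveI : IsDomain (coneRing ℂ g) := Ideal.Quotient.isDomain _
    obtain ⟨k, hk⟩ := exists_ne j
    let τ : Cox ℂ n 3 →ₐ[ℂ] FractionRing (coneRing ℂ g) :=
      (IsScalarTower.toAlgHom ℂ (coneRing ℂ g) (FractionRing (coneRing ℂ g))).comp
        (Ideal.Quotient.mkₐ ℂ (Ideal.span {g}))
    have hker : ∀ f, τ f = 0 ↔ g ∣ f := by
      intro f
      simp only [τ, AlgHom.comp_apply, IsScalarTower.coe_toAlgHom', Ideal.Quotient.mkₐ_eq_mk]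
      rw [FaithfulSMul.algebraMap_eq_zero_iff, Ideal.Quotient.eq_zero_iff_mem,
        Ideal.mem_span_singleton]
    exact cb_rat w d g τ hker hb j k hk ⟨0, by omega⟩ hle hex
  · exfalso
    push Not at hex
    have hz : ∀ e ∈ g.support, e (Sum.inr j) = 0 := by
      intro e he; have := hle e he; have := hex e he; omega
    let T : Finset (Fin n ⊕ Fin 3) := (Finset.univ.erase j).map ⟨Sum.inr, Sum.inr_injective⟩
    have hT : T.card = 2 := by simp [T]
    let P : Ideal (Cox ℂ n 3) := Ideal.span ((X : _ → Cox ℂ n 3) '' (T : Set _))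
    have hP : P.IsPrime := cb_spanX_prime _
    have hX : ∀ v, v ∉ T → (X v : Cox ℂ n 3) ∉ P := by
      intro v hv h
      rw [mem_ideal_span_X_image] at h
      obtain ⟨i, hi, hi'⟩ := h (Finsupp.single v 1) (by simp [support_X])
      have : v = i := by
        by_contra hne; simp [Finsupp.single_apply, hne] at hi'
      exact hv (this ▸ hi)
    have hrel : RelevantPrime ℂ P :=
      ⟨⟨⟨0, by omega⟩, hX _ (by simp [T])⟩, ⟨j, hX _ (by simp [T])⟩⟩
    have hTs : ∀ e ∈ g.support, ∑ v ∈ T, e v = 2 := by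
      intro e he
      rw [← hdeg e he, Finset.sum_map, ← Finset.add_sum_erase _ _ (Finset.mem_univ j), hz e he]
      simp
    have hgP : g ∈ P := by
      rw [mem_ideal_span_X_image]
      intro e he
      have := hTs e he
      by_contra hc
      push Not at hc
      rw [Finset.sum_eq_zero hc] at this
      omega
    have hdP : ∀ v, pderiv v g ∈ P := by
      intro v
      rw [mem_ideal_span_X_image]
      intro e he
      rw [mem_support_iff, coeff_pderiv] at he
      have h2 := hTs _ (mem_support_iff.2 (left_ne_zero_of_mul he))
      by_contra hc
      push Not at hc
      simp only [Finsupp.add_apply, Finset.sum_add_distrib] at h2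
      rw [Finset.sum_eq_zero hc] at h2
      have h3 : ∑ x ∈ T, (Finsupp.single v 1 x : ℕ) ≤ 1 := by
        simp only [Finsupp.single_apply, Finset.sum_ite_eq]
        split_ifs <;> omega
      omega
    have h4 := hg.terminal.2 ⟨P, hP⟩ hrel hgP hdP
    rw [IsLocalization.AtPrime.ringKrullDim_eq_height P] at h4
    have h5 : P.height ≤ (T.image (X : _ → Cox ℂ n 3)).card := by
      refine Ideal.height_le_card_of_mem_minimalPrimes_span_finset (s := T.image X) ?_
      rw [Finset.coe_image]
      change P ∈ P.minimalPrimes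
      rw [Ideal.minimalPrimes_eq_subsingleton_self]
      rfl
    have h6 : (T.image (X : _ → Cox ℂ n 3)).card ≤ 2 := hT ▸ Finset.card_image_le
    have h7 : P.height ≤ (2 : ℕ) := h5.trans (by exact_mod_cast h6)
    have h8 : ((3 + 1 : ℕ) : WithBot ℕ∞) ≤ (((2 : ℕ) : ℕ∞) : WithBot ℕ∞) :=
      h4.trans (WithBot.coe_le_coe.2 h7)
    have h9 : (((3 + 1 : ℕ) : ℕ∞) : WithBot ℕ∞) ≤ (((2 : ℕ) : ℕ∞) : WithBot ℕ∞) := h8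
    have h10 : ((3 + 1 : ℕ) : ℕ∞) ≤ ((2 : ℕ) : ℕ∞) := WithBot.coe_le_coe.1 h9
    have h11 : (3 + 1 : ℕ) ≤ 2 := Nat.cast_le.1 h10
    omega

theorem cb_finite (n : ℕ) (w : Fin 3 → ℤ) (d : ℤ) :
    ∃ S : Finset ((Fin n ⊕ Fin 3) →₀ ℕ), ∀ e, e ∈ S ↔
      (∑ v, (e v : ℤ) * cbWt w v = d ∧ ∑ v, e v * cbBt v = 2) := by
  classical
  let B : ℕ := (2 + |d| + 2 * ∑ l, |w l|).toNat
  have hfin : {e : (Fin n ⊕ Fin 3) →₀ ℕ | ∑ v, (e v : ℤ) * cbWt w v = d ∧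
      ∑ v, e v * cbBt v = 2}.Finite := by
    refine (Set.finite_Iic (Finsupp.equivFunOnFinite.symm (fun _ : Fin n ⊕ Fin 3 => B))).subset ?_
    rintro e ⟨h1, h2⟩
    rw [Set.mem_Iic, Finsupp.le_def]
    simp only [Fintype.sum_sum_type, cbWt, cbBt, Sum.elim_inl, Sum.elim_inr, mul_one, mul_zero,
      Finset.sum_const_zero, zero_add] at h1 h2
    have hB : (B : ℤ) = 2 + |d| + 2 * ∑ l, |w l| := by
      apply Int.toNat_of_nonneg
      have : 0 ≤ ∑ l, |w l| := Finset.sum_nonneg fun _ _ => abs_nonneg _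
      positivity
    have hl : ∀ l : Fin 3, e (Sum.inr l) ≤ 2 := by
      intro l
      rw [← h2]
      exact Finset.single_le_sum (f := fun l => e (Sum.inr l)) (fun _ _ => Nat.zero_le _) (Finset.mem_univ l)
    have h0 : 0 ≤ ∑ l, |w l| := Finset.sum_nonneg fun _ _ => abs_nonneg _
    have h3 : -(2 * ∑ l, |w l|) ≤ ∑ l, (e (Sum.inr l) : ℤ) * w l := by
      rw [Finset.mul_sum, ← Finset.sum_neg_distrib]
      refine Finset.sum_le_sum fun l _ => ?_
      have a1 : ((e (Sum.inr l) : ℕ) : ℤ) ≤ 2 := by exact_mod_cast hl l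
      have a2 := neg_abs_le (w l)
      have a3 := abs_nonneg (w l)
      have a4 : (0 : ℤ) ≤ e (Sum.inr l) := by positivity
      nlinarith
    have hd := le_abs_self d
    have hd0 := abs_nonneg d
    rintro (i | l)
    · have : (e (Sum.inl i) : ℤ) ≤ ∑ i, (e (Sum.inl i) : ℤ) :=
        Finset.single_le_sum (f := fun l => (e (Sum.inl l) : ℤ)) (fun _ _ => by positivity) (Finset.mem_univ i)
      have : (e (Sum.inl i) : ℤ) ≤ B := by linarith
      simpa using this
    · have : (e (Sum.inr l) : ℤ) ≤ B := by
        have : (e (Sum.inr l) : ℤ) ≤ 2 := by exact_mod_cast hl l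
        linarith
      simpa using this
  refine ⟨hfin.toFinset, fun e => by simp⟩

theorem cb_conj {σ ι K : Type} [Fintype ι] [Field K] [Infinite K] (S : Finset (σ →₀ ℕ))
    (D : ι → MvPolynomial (σ →₀ ℕ) K)
    (h : ∀ i, ∃ p0 : MvPolynomial σ K, p0.support ⊆ S ∧ eval (fun e => p0.coeff e) (D i) ≠ 0) :
    ∃ p0 : MvPolynomial σ K, p0.support ⊆ S ∧ eval (fun e => p0.coeff e) (∏ i, D i) ≠ 0 := by
  classical
  let φ : MvPolynomial (σ →₀ ℕ) K →ₐ[K] MvPolynomial S K :=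
    aeval (fun e => if h : e ∈ S then X ⟨e, h⟩ else 0)
  have hφ : ∀ p0 : MvPolynomial σ K, p0.support ⊆ S → ∀ f,
      eval (fun e : S => p0.coeff e) (φ f) = eval (fun e => p0.coeff e) f := by
    intro p0 hp f
    induction f using MvPolynomial.induction_on with
    | C a => simp [φ, algebraMap_eq]
    | add p q hp hq => simp only [map_add, hp, hq]
    | mul_X p e ih =>
      rw [map_mul, map_mul, ih, map_mul]
      congr 1
      by_cases he : e ∈ S
      · simp [φ, he]
      · have : p0.coeff e = 0 := by
          by_contra hc; exact he (hp (mem_support_iff.2 hc))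
        simp [φ, he, this]
  have hne : φ (∏ i, D i) ≠ 0 := by
    rw [map_prod]
    refine Finset.prod_ne_zero_iff.2 fun i _ hi => ?_
    obtain ⟨p0, hp, hp'⟩ := h i
    rw [← hφ p0 hp, hi, map_zero] at hp'
    exact hp' rfl
  obtain ⟨c, hc⟩ : ∃ c : S → K, eval c (φ (∏ i, D i)) ≠ 0 := by
    by_contra hcon
    push Not at hcon
    exact hne (MvPolynomial.funext fun c => by rw [hcon c, map_zero])
  let p0 : MvPolynomial σ K := ∑ e : S, monomial (e : σ →₀ ℕ) (c e)
  have hco : ∀ e : S, p0.coeff (e : σ →₀ ℕ) = c e := by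
    intro e
    simp only [p0, coeff_sum, coeff_monomial]
    rw [Finset.sum_eq_single e]
    · simp
    · intro b _ hb
      rw [if_neg]
      exact fun h => hb (Subtype.ext h)
    · simp
  have hs : p0.support ⊆ S := by
    intro e he
    obtain ⟨e', _, h⟩ := Finset.mem_biUnion.1 (support_sum he)
    have := support_monomial_subset h
    rw [Finset.mem_singleton] at this
    rw [this]; exact e'.2
  refine ⟨p0, hs, ?_⟩
  rw [← hφ p0 hs]
  simpa [hco] using hc

theorem cb_pderiv_bihom {K : Type} [Field K] {n : ℕ} (w : Fin 3 → ℤ) (α : ℤ) (β : ℕ) (g : Cox K n 3)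
    (hg : IsBihom K n 3 w (fun _ => 1) α β g) (v : Fin n ⊕ Fin 3) :
    IsBihom K n 3 w (fun _ => 1) (α - cbWt w v) (β - cbBt v) (pderiv v g) := by
  rw [cb_bihom_iff] at hg ⊢
  intro e he
  rw [mem_support_iff, coeff_pderiv] at he
  obtain ⟨h1, h2⟩ := hg _ (mem_support_iff.2 (left_ne_zero_of_mul he))
  simp only [Finsupp.add_apply, Nat.cast_add, add_mul, Finset.sum_add_distrib] at h1 h2
  rw [cb_sum_single_int] at h1
  rw [cb_sum_single_nat] at h2
  push_cast at h1
  constructor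
  · linarith
  · omega

theorem cb_chart1 {K : Type} [Field K] [Infinite K] {n : ℕ} (w : Fin 3 → ℤ) (d : ℤ)
    (hw : ∀ l, 2 * w l ≤ d) (S : Finset ((Fin n ⊕ Fin 3) →₀ ℕ))
    (hS : ∀ e, e ∈ S ↔ (∑ v, (e v : ℤ) * cbWt w v = d ∧ ∑ v, e v * cbBt v = 2))
    (i : Fin n) (j : Fin 3) (hj : 2 * w j < d) :
    ∃ D : MvPolynomial ((Fin n ⊕ Fin 3) →₀ ℕ) K,
      (∃ p0 : Cox K n 3, p0.support ⊆ S ∧ eval (fun e => p0.coeff e) D ≠ 0) ∧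
      ∀ g : Cox K n 3, g.support ⊆ S → ∀ p : Fin n ⊕ Fin 3 → K, p (Sum.inl i) ≠ 0 →
        p (Sum.inr j) ≠ 0 →
        eval p g = 0 → (∀ v, eval p (pderiv v g) = 0) → eval (fun e => g.coeff e) D = 0 := by
  classical
  let V : Finset (Fin n ⊕ Fin 3) := Finset.univ \ {Sum.inl i, Sum.inr j}
  let q : ℤ → ℕ → (Fin n ⊕ Fin 3 →₀ ℕ) := fun a b =>
    Finsupp.single (Sum.inl i) (d - a - ((2 - b : ℕ) : ℤ) * w j).toNat + Finsupp.single (Sum.inr j) (2 - b)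
  let r : Option V → (Fin n ⊕ Fin 3 →₀ ℕ) := fun t => match t with
    | none => q 0 0
    | some v => q (cbWt w v.1) (cbBt v.1)
  have hq : ∀ a b x, q a b x ≠ 0 → x = Sum.inl i ∨ x = Sum.inr j := by
    intro a b x hx
    by_contra hc
    push Not at hc
    apply hx
    simp [q, Finsupp.single_apply, Ne.symm hc.1, Ne.symm hc.2]
  have hm0 : q 0 0 ∈ S := by
    rw [hS]
    simp only [q, Finsupp.add_apply, Nat.cast_add, add_mul, Finset.sum_add_distrib]
    rw [cb_sum_single_int, cb_sum_single_int, cb_sum_single_nat, cb_sum_single_nat]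
    simp only [cbWt, cbBt, Sum.elim_inl, Sum.elim_inr]
    constructor
    · rw [Int.toNat_of_nonneg (by push_cast; linarith)]; ring
    · omega
  have hm : ∀ v : Fin n ⊕ Fin 3, Finsupp.single v 1 + q (cbWt w v) (cbBt v) ∈ S := by
    intro v
    rw [hS]
    simp only [q, Finsupp.add_apply, Nat.cast_add, add_mul, Finset.sum_add_distrib]
    rw [cb_sum_single_int, cb_sum_single_int, cb_sum_single_int, cb_sum_single_nat,
      cb_sum_single_nat, cb_sum_single_nat]
    rcases v with k | k
    · simp only [cbWt, cbBt, Sum.elim_inl, Sum.elim_inr]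
      constructor
      · rw [Int.toNat_of_nonneg (by push_cast; linarith)]; push_cast; ring
      · omega
    · simp only [cbWt, cbBt, Sum.elim_inl, Sum.elim_inr]
      have := hw k
      constructor
      · rw [Int.toNat_of_nonneg (by push_cast; linarith)]; push_cast; ring
      · omega
  obtain ⟨D, hD0, hD⟩ := cbAux_chart (K := K) S V (fun _ => 1) r
    (by
      rintro (_ | v) x hx
      · refine ⟨?_, rfl⟩
        rcases hq _ _ _ hx with rfl | rfl <;> simp [V]
      · refine ⟨?_, rfl⟩
        rcases hq _ _ _ hx with rfl | rfl <;> simp [V])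
    (fun t => match t with
      | none => ⟨q 0 0, hm0⟩
      | some v => ⟨_, hm v.1⟩) rfl (fun v => rfl)
  refine ⟨D, hD0, ?_⟩
  intro g hg p hpi hpj hpg hpd
  have hgb : IsBihom K n 3 w (fun _ => 1) d 2 g := by
    rw [cb_bihom_iff]; intro e he; exact (hS e).1 (hg he)
  set U := p (Sum.inl i) with hU
  set W := p (Sum.inr j) * U ^ (- w j) with hWdef
  have hW : W ≠ 0 := mul_ne_zero hpj (zpow_ne_zero _ hpi)
  let ζ : Fin n ⊕ Fin 3 → K := fun v => p v / (U ^ cbWt w v * W ^ cbBt v)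
  have hsc : ∀ α β f, IsBihom K n 3 w (fun _ => 1) α β f → eval p f = 0 → eval ζ f = 0 := by
    intro α β f hf h0
    have := cb_scale (K := K) w U W hpi p ζ (fun v => by
      have : U ^ cbWt w v * W ^ cbBt v ≠ 0 := mul_ne_zero (zpow_ne_zero _ hpi) (pow_ne_zero _ hW)
      simp only [ζ]
      rw [mul_div_cancel₀ _ this]) α β f hf
    rw [aeval_eq_eval, aeval_eq_eval] at this
    rw [h0] at this
    have hne : U ^ α * W ^ β ≠ 0 := mul_ne_zero (zpow_ne_zero _ hpi) (pow_ne_zero _ hW)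
    exact (mul_eq_zero.1 this.symm).resolve_left hne
  refine hD g hg ζ ?_ (hsc _ _ _ hgb hpg) (fun v _ => hsc _ _ _ (cb_pderiv_bihom w d 2 g hgb v) (hpd v))
  intro x hx
  have : x = Sum.inl i ∨ x = Sum.inr j := by simpa [V, or_iff_not_imp_left] using hx
  rcases this with rfl | rfl
  · simp [ζ, cbWt, cbBt, ← hU, hpi]
  · simp only [ζ, cbWt, cbBt, Sum.elim_inr, pow_one, W]
    rw [mul_left_comm, ← zpow_add₀ hpi]
    simp [hpj]

theorem cb_eval_zero {K : Type} [Field K] {n : ℕ} (w : Fin 3 → ℤ) (d : ℤ) (f : Cox K n 3)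
    (hf : ∀ e ∈ f.support, (∀ l, 2 * w l ≠ d → e (Sum.inr l) = 0) → ∀ i, e (Sum.inl i) = 0)
    (ζ ζ' : Fin n ⊕ Fin 3 → K) (h1 : ∀ l, ζ (Sum.inr l) = ζ' (Sum.inr l))
    (h2 : ∀ l, 2 * w l ≠ d → ζ (Sum.inr l) = 0) : eval ζ f = eval ζ' f := by
  rw [eval_eq', eval_eq']
  refine Finset.sum_congr rfl fun e he => ?_
  congr 1
  rw [Fintype.prod_sum_type, Fintype.prod_sum_type]
  by_cases h : ∀ l, 2 * w l ≠ d → e (Sum.inr l) = 0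
  · have := hf e he h
    simp [this, h1]
  · push Not at h
    obtain ⟨l, hl, hl'⟩ := h
    have a1 : ∏ l, ζ (Sum.inr l) ^ e (Sum.inr l) = 0 :=
      Finset.prod_eq_zero (Finset.mem_univ l) (by rw [h2 l hl, zero_pow hl'])
    have a2 : ∏ l, ζ' (Sum.inr l) ^ e (Sum.inr l) = 0 :=
      Finset.prod_eq_zero (Finset.mem_univ l) (by rw [← h1, h2 l hl, zero_pow hl'])
    rw [a1, a2, mul_zero, mul_zero]

theorem cb_chart2 {K : Type} [Field K] [Infinite K] {n : ℕ} (w : Fin 3 → ℤ) (d : ℤ)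
    (S : Finset ((Fin n ⊕ Fin 3) →₀ ℕ))
    (hS : ∀ e, e ∈ S ↔ (∑ v, (e v : ℤ) * cbWt w v = d ∧ ∑ v, e v * cbBt v = 2))
    (j : Fin 3) (hj : 2 * w j = d) :
    ∃ D : MvPolynomial ((Fin n ⊕ Fin 3) →₀ ℕ) K,
      (∃ p0 : Cox K n 3, p0.support ⊆ S ∧ eval (fun e => p0.coeff e) D ≠ 0) ∧
      ∀ g : Cox K n 3, g.support ⊆ S → ∀ p : Fin n ⊕ Fin 3 → K,
        p (Sum.inr j) ≠ 0 → (∀ l, 2 * w l ≠ d → p (Sum.inr l) = 0) →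
        eval p g = 0 → (∀ v, eval p (pderiv v g) = 0) → eval (fun e => g.coeff e) D = 0 := by
  classical
  let V : Finset (Fin n ⊕ Fin 3) :=
    (Finset.univ.filter (fun k : Fin 3 => 2 * w k = d ∧ k ≠ j)).map ⟨Sum.inr, Sum.inr_injective⟩
  have hV : ∀ x, x ∈ V ↔ ∃ k, 2 * w k = d ∧ k ≠ j ∧ x = Sum.inr k := by
    intro x
    simp only [V, Finset.mem_map, Finset.mem_filter, Finset.mem_univ, true_and,
      Function.Embedding.coeFn_mk]
    constructor
    · rintro ⟨k, ⟨a, b⟩, rfl⟩; exact ⟨k, a, b, rfl⟩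
    · rintro ⟨k, a, b, rfl⟩; exact ⟨k, ⟨a, b⟩, rfl⟩
  let r : Option V → (Fin n ⊕ Fin 3 →₀ ℕ) := fun t => match t with
    | none => Finsupp.single (Sum.inr j) 2
    | some _ => Finsupp.single (Sum.inr j) 1
  have hm0 : Finsupp.single (Sum.inr j) 2 ∈ S := by
    rw [hS, cb_sum_single_int, cb_sum_single_nat]
    simp only [cbWt, cbBt, Sum.elim_inr]
    exact ⟨by push_cast; exact hj, by norm_num⟩
  have hm : ∀ v ∈ V, Finsupp.single v 1 + Finsupp.single (Sum.inr j) 1 ∈ S := by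
    intro v hv
    obtain ⟨k, hk, _, rfl⟩ := (hV v).1 hv
    rw [hS]
    simp only [Finsupp.add_apply, Nat.cast_add, add_mul, Finset.sum_add_distrib]
    rw [cb_sum_single_int, cb_sum_single_int, cb_sum_single_nat, cb_sum_single_nat]
    simp only [cbWt, cbBt, Sum.elim_inr]
    exact ⟨by push_cast; linarith, by norm_num⟩
  have hjV : Sum.inr j ∉ V := by
    rw [hV]; rintro ⟨k, _, h, h'⟩; exact h (Sum.inr_injective h').symm
  let b : Fin n ⊕ Fin 3 → K := Pi.single (Sum.inr j) 1
  obtain ⟨D, hD0, hD⟩ := cbAux_chart (K := K) S V b r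
    (by
      rintro t x hx
      have : x = Sum.inr j := by
        by_contra hc
        apply hx
        rcases t with _ | t <;> simp [r, Finsupp.single_apply, Ne.symm hc]
      subst this
      exact ⟨hjV, by simp [b]⟩)
    (fun t => match t with
      | none => ⟨_, hm0⟩
      | some v => ⟨_, hm v.1 v.2⟩) rfl (fun v => rfl)
  refine ⟨D, hD0, ?_⟩
  intro g hg p hpj hpl hpg hpd
  have hgb : IsBihom K n 3 w (fun _ => 1) d 2 g := by
    rw [cb_bihom_iff]; intro e he; exact (hS e).1 (hg he)
  set W := p (Sum.inr j) with hWdef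
  let ζ : Fin n ⊕ Fin 3 → K := fun v => p v / ((1 : K) ^ cbWt w v * W ^ cbBt v)
  have hsc : ∀ α β f, IsBihom K n 3 w (fun _ => 1) α β f → eval p f = 0 → eval ζ f = 0 := by
    intro α β f hf h0
    have := cb_scale (K := K) w 1 W one_ne_zero p ζ (fun v => by
      have : (1 : K) ^ cbWt w v * W ^ cbBt v ≠ 0 :=
        mul_ne_zero (zpow_ne_zero _ one_ne_zero) (pow_ne_zero _ hpj)
      simp only [ζ]
      rw [mul_div_cancel₀ _ this]) α β f hf
    rw [aeval_eq_eval, aeval_eq_eval] at this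
    rw [h0] at this
    have hne : (1 : K) ^ α * W ^ β ≠ 0 := mul_ne_zero (zpow_ne_zero _ one_ne_zero) (pow_ne_zero _ hpj)
    exact (mul_eq_zero.1 this.symm).resolve_left hne
  let ζ' : Fin n ⊕ Fin 3 → K := Sum.elim (fun _ => 0) (fun l => ζ (Sum.inr l))
  have hζl : ∀ l, 2 * w l ≠ d → ζ (Sum.inr l) = 0 := by
    intro l hl; simp [ζ, hpl l hl]
  have hg1 : ∀ e ∈ g.support, (∀ l, 2 * w l ≠ d → e (Sum.inr l) = 0) → ∀ i, e (Sum.inl i) = 0 := by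
    intro e he hel i
    obtain ⟨h1, h2⟩ := hgb e he
    have h3 : ∀ l, (e (Sum.inr l) : ℤ) * w l * 2 = e (Sum.inr l) * d := by
      intro l
      by_cases hl : 2 * w l = d
      · rw [← hl]; ring
      · rw [hel l hl]; simp
    have h4 : (∑ l, (e (Sum.inr l) : ℤ) * w l) * 2 = 2 * d := by
      rw [Finset.sum_mul, Finset.sum_congr rfl (fun l _ => h3 l), ← Finset.sum_mul]
      congr 1
      have : ∑ l : Fin 3, e (Sum.inr l) = 2 := by simpa using h2
      exact_mod_cast this
    have h5 : ∑ i, (e (Sum.inl i) : ℤ) = 0 := by linarith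
    have h6 := (Finset.sum_eq_zero_iff_of_nonneg (fun _ _ => by positivity)).1 h5 i (Finset.mem_univ i)
    exact_mod_cast h6
  refine hD g hg ζ' ?_ ?_ ?_
  · rintro (i | l) hx
    · simp [ζ', b]
    · by_cases hl : 2 * w l = d
      · have : l = j := by
          by_contra hc; exact hx ((hV _).2 ⟨l, hl, hc, rfl⟩)
        subst this
        simp [ζ', ζ, b, cbBt, ← hWdef, hpj]
      · have hlj : l ≠ j := by rintro rfl; exact hl hj
        simp only [ζ', Sum.elim_inr, hζl l hl, b]
        rw [Pi.single_eq_of_ne (by simpa using hlj)]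
  · rw [← cb_eval_zero w d g hg1 ζ ζ' (fun l => rfl) hζl]
    exact hsc _ _ _ hgb hpg
  · intro v hv
    obtain ⟨k, hk, _, rfl⟩ := (hV v).1 hv
    rw [← cb_eval_zero w d _ ?_ ζ ζ' (fun l => rfl) hζl]
    · exact hsc _ _ _ (cb_pderiv_bihom w d 2 g hgb _) (hpd _)
    · intro e he hel i
      rw [mem_support_iff, coeff_pderiv] at he
      have := hg1 _ (mem_support_iff.2 (left_ne_zero_of_mul he)) (by
        intro l hl
        have hlk : k ≠ l := by rintro rfl; exact hl hk
        simp [hel l hl, Finsupp.single_apply, hlk]) i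
      simpa using this

theorem cb_caseB (n : ℕ) (w : Fin 3 → ℤ) (d : ℤ) (hw : ∀ l, 2 * w l ≤ d) :
    GenerallyHolds ℂ n 3 w (fun _ => 1) d 2 (fun g => IsSmoothModel ℂ g) := by
  classical
  obtain ⟨S, hS⟩ := cb_finite n w d
  have hbS : ∀ g : Cox ℂ n 3, IsBihom ℂ n 3 w (fun _ => 1) d 2 g ↔ g.support ⊆ S := by
    intro g
    rw [cb_bihom_iff]
    exact forall₂_congr fun e _ => (hS e).symm
  have h1 : ∀ t : Fin n × Fin 3, ∃ D : MvPolynomial ((Fin n ⊕ Fin 3) →₀ ℕ) ℂ,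
      (∃ p0 : Cox ℂ n 3, p0.support ⊆ S ∧ eval (fun e => p0.coeff e) D ≠ 0) ∧
      (2 * w t.2 < d → ∀ g : Cox ℂ n 3, g.support ⊆ S → ∀ p : Fin n ⊕ Fin 3 → ℂ,
        p (Sum.inl t.1) ≠ 0 → p (Sum.inr t.2) ≠ 0 →
        eval p g = 0 → (∀ v, eval p (pderiv v g) = 0) → eval (fun e => g.coeff e) D = 0) := by
    rintro ⟨i, j⟩
    by_cases hj : 2 * w j < d
    · obtain ⟨D, h, h'⟩ := cb_chart1 (K := ℂ) w d hw S hS i j hj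
      exact ⟨D, h, fun _ => h'⟩
    · exact ⟨1, ⟨0, by simp, by simp⟩, fun h => absurd h hj⟩
  have h2 : ∀ j : Fin 3, ∃ D : MvPolynomial ((Fin n ⊕ Fin 3) →₀ ℕ) ℂ,
      (∃ p0 : Cox ℂ n 3, p0.support ⊆ S ∧ eval (fun e => p0.coeff e) D ≠ 0) ∧
      (2 * w j = d → ∀ g : Cox ℂ n 3, g.support ⊆ S → ∀ p : Fin n ⊕ Fin 3 → ℂ,
        p (Sum.inr j) ≠ 0 → (∀ l, 2 * w l ≠ d → p (Sum.inr l) = 0) →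
        eval p g = 0 → (∀ v, eval p (pderiv v g) = 0) → eval (fun e => g.coeff e) D = 0) := by
    intro j
    by_cases hj : 2 * w j = d
    · obtain ⟨D, h, h'⟩ := cb_chart2 (K := ℂ) w d S hS j hj
      exact ⟨D, h, fun _ => h'⟩
    · exact ⟨1, ⟨0, by simp, by simp⟩, fun h => absurd h hj⟩
  choose D1 hD1 hD1' using h1
  choose D2 hD2 hD2' using h2
  obtain ⟨p0, hp0, hp0'⟩ := cb_conj S (Sum.elim D1 D2) (by
    rintro (t | j)
    · exact hD1 t
    · exact hD2 j)
  refine ⟨∏ i, Sum.elim D1 D2 i, ⟨p0, (hbS p0).2 hp0, hp0'⟩, ?_⟩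
  intro g hg hgD
  have hgD' : ∀ i, eval (fun e => g.coeff e) (Sum.elim D1 D2 i) ≠ 0 := by
    intro i hi
    apply hgD
    unfold evalCoeff
    rw [map_prod]
    exact Finset.prod_eq_zero (Finset.mem_univ i) hi
  have hgS := (hbS g).1 hg
  intro p hp hpg
  by_contra hcon
  push Not at hcon
  obtain ⟨i, hi⟩ := Function.ne_iff.1 hp.1
  obtain ⟨j, hj⟩ := Function.ne_iff.1 hp.2
  let P : Fin n ⊕ Fin 3 → ℂ := Sum.elim p.1 p.2
  by_cases hc : ∃ l, 2 * w l < d ∧ p.2 l ≠ 0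
  · obtain ⟨l, hl, hl'⟩ := hc
    exact hgD' (Sum.inl (i, l)) (hD1' (i, l) hl g hgS P hi hl' hpg hcon)
  · push Not at hc
    have hjd : 2 * w j = d := by
      by_contra hne
      exact hj (hc j (lt_of_le_of_ne (hw j) hne))
    exact hgD' (Sum.inr j) (hD2' j hjd g hgS P hj
      (fun l hl => hc l (lt_of_le_of_ne (hw l) hl)) hpg hcon)

/-- **Proposition 2.5/2.11 (rationality of singular members).**  A general member
`X` of its linear system giving an embedded conic bundle `π : X → ℙ^{n-1}` which is
singular is rational. -/
theorem prop_singular_embedded_conic_bundle_rational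
    (n : ℕ) (hn : 3 ≤ n) (w : Fin 3 → ℤ) (d : ℤ) :
    GenerallyHolds ℂ n 3 w (fun _ => 1) d 2 (fun g =>
      IsConicBundleModel ℂ n w d g →
      ¬ IsSmoothModel ℂ g →
      IsRationalModel ℂ w (fun _ => 1) g) := by
  by_cases h : ∃ j, d < 2 * w j
  · obtain ⟨j, hj⟩ := h
    refine ⟨1, ⟨0, ?_, ?_⟩, ?_⟩
    · intro e he; simp at he
    · simp [evalCoeff]
    · intro g _ _ hg _
      exact cb_caseA n hn w d j hj g hg
  · push Not at h
    obtain ⟨D, h0, hD⟩ := cb_caseB n w d h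
    exact ⟨D, h0, fun g hg hgD _ hns => absurd (hD g hg hgD) hns⟩

end ConicBundleFormalization
end
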